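/- arXiv:1709.03475 — 8 statements merged into one kernel-verified Lean document; each statement's English description precedes it below -/
import Mathlib

section
/- Let 0 < T < S < 1 be real numbers and let t be any complex number. Then A_t(S,T) = π/(√(1−T)·√(1−S)). -/
open MeasureTheory

/-- The closed form of the product of the two hypergeometric factors:
`K_t(z) = cos(4·i·t·arcsin(√Y(z))) · cos(2·t·log(√(x(z)+1)+√x(z)))`, where
`Y(z) = (1+√z)(√z−√T)/(2(1−√T)√z)` and `x(z) = (S−z)(1−z)/((1−√S)²z)`. -/
noncomputable def Kker (S T : ℝ) (t : ℂ) (z : ℝ) : ℂ :=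
  Complex.cos (4 * Complex.I * t *
      (Real.arcsin (Real.sqrt ((1 + Real.sqrt z) * (Real.sqrt z - Real.sqrt T) /
        (2 * (1 - Real.sqrt T) * Real.sqrt z))) : ℝ)) *
  Complex.cos (2 * t *
      (Real.log (Real.sqrt ((S - z) * (1 - z) / ((1 - Real.sqrt S) ^ 2 * z) + 1) +
        Real.sqrt ((S - z) * (1 - z) / ((1 - Real.sqrt S) ^ 2 * z))) : ℝ))

/-- `A_t(S,T) = ∫_T^S K_t(z)/((1−z)√(z−T)√(S−z)) dz`. -/
noncomputable def Aint (S T : ℝ) (t : ℂ) : ℂ :=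
  ∫ z in T..S, Kker S T t z /
    (((1 - z : ℝ) : ℂ) * (Real.sqrt (z - T) : ℝ) * (Real.sqrt (S - z) : ℝ))


/-- `cos (2 t arccosh ζ)`. -/
noncomputable def Gf (t ζ : ℂ) : ℂ :=
  Complex.cos (2 * t * Complex.log (ζ + (ζ ^ 2 - 1) ^ ((2 : ℕ)⁻¹ : ℂ)))

lemma Gf_eq (t ζ E : ℂ) (hE : E ∈ Complex.slitPlane) (h : E * E + 1 = 2 * ζ * E) :
    Gf t ζ = Complex.cos (2 * t * Complex.log E) := by
  have hE0 : E ≠ 0 := Complex.slitPlane_ne_zero hE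
  unfold Gf
  set s := (ζ ^ 2 - 1) ^ ((2 : ℕ)⁻¹ : ℂ) with hs
  have hs2 : s ^ 2 = ζ ^ 2 - 1 := Complex.cpow_nat_inv_pow _ two_ne_zero
  have : (s - (E - ζ)) * (s + (E - ζ)) = 0 := by linear_combination hs2 - h
  rcases mul_eq_zero.1 this with h1 | h1
  · have : ζ + s = E := by linear_combination h1
    rw [this]
  · have : ζ + s = E⁻¹ := by
      field_simp
      linear_combination E * h1 - h
    rw [this, Complex.log_inv _ (Complex.slitPlane_arg_ne_pi hE), mul_neg, Complex.cos_neg]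

lemma slit_of (ζ s : ℂ) (hζ : ζ + 1 ∈ Complex.slitPlane) (hs : s ^ 2 = ζ ^ 2 - 1) :
    ζ + s ∈ Complex.slitPlane := by
  by_contra hn
  rw [Complex.mem_slitPlane_iff] at hn hζ
  push Not at hn
  obtain ⟨h1, h2⟩ := hn
  set E := ζ + s with hE
  have h : E * E + 1 = 2 * ζ * E := by rw [hE]; linear_combination hs
  have hEr : E = (E.re : ℂ) := by apply Complex.ext <;> simp [h2]
  set x := E.re with hx
  rw [hEr] at h
  have hre := congrArg Complex.re h
  have him := congrArg Complex.im h
  simp at hre him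
  have hx0 : x ≠ 0 := by rintro h0; rw [h0] at hre; norm_num at hre
  have him0 : ζ.im = 0 := by tauto
  have hxn : x < 0 := lt_of_le_of_ne h1 hx0
  simp [him0] at hζ
  nlinarith [sq_nonneg (x+1)]

lemma Gf_cos (t w : ℂ) (h1 : -Real.pi < w.im) (h2 : w.im < Real.pi) :
    Gf t (Complex.cosh w) = Complex.cos (2 * t * w) := by
  have h := Gf_eq t (Complex.cosh w) (Complex.exp w) ?_ ?_
  · rw [h, Complex.log_exp h1 h2.le]
  · rw [Complex.mem_slitPlane_iff_arg]
    refine ⟨?_, Complex.exp_ne_zero _⟩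
    rw [← Complex.log_im, Complex.log_exp h1 h2.le]
    exact h2.ne
  · rw [Complex.cosh, Complex.exp_neg]
    field_simp [Complex.exp_ne_zero]

lemma Gf_diff (t ζ : ℂ) (hζ : ζ + 1 ∈ Complex.slitPlane) : DifferentiableAt ℂ (Gf t) ζ := by
  have hopen : IsOpen {ζ : ℂ | ζ + 1 ∈ Complex.slitPlane} :=
    Complex.isOpen_slitPlane.preimage (by fun_prop)
  have h1mem : (1 : ℂ) ∈ {ζ : ℂ | ζ + 1 ∈ Complex.slitPlane} := by
    left; norm_num
  have hsq : ∀ y : ℂ, (y ^ ((2 : ℕ)⁻¹ : ℂ)) ^ 2 = y := fun y =>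
    Complex.cpow_nat_inv_pow _ two_ne_zero
  have key : DifferentiableOn ℂ (Gf t) {ζ : ℂ | ζ + 1 ∈ Complex.slitPlane} := by
    rw [← Complex.differentiableOn_compl_singleton_and_continuousAt_iff (c := 1)
      (hopen.mem_nhds h1mem)]
    constructor
    · rintro y ⟨hy, hy1⟩
      apply DifferentiableAt.differentiableWithinAt
      have hy1 : y ≠ 1 := hy1
      have hym : y ≠ -1 := by
        rintro rfl
        simp at hy
      have hne : y ^ 2 - 1 ≠ 0 := by
        intro h0
        have : (y - 1) * (y + 1) = 0 := by linear_combination h0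
        rcases mul_eq_zero.1 this with h | h
        · exact hy1 (by linear_combination h)
        · exact hym (by linear_combination h)
      by_cases hsl : y ^ 2 - 1 ∈ Complex.slitPlane
      · unfold Gf
        have := slit_of y _ hy (hsq (y ^ 2 - 1))
        fun_prop (disch := assumption)
      · have hsl' : 1 - y ^ 2 ∈ Complex.slitPlane := by
          rw [Complex.mem_slitPlane_iff] at hsl ⊢
          push Not at hsl
          left
          rcases hsl.1.lt_or_eq with h | h
          · have : (1 - y ^ 2) = -(y ^ 2 - 1) := by ring
            rw [this, Complex.neg_re]; linarith
          · exact absurd (Complex.ext h hsl.2) hne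
        have hs' : ∀ x : ℂ, (Complex.I * (1 - x ^ 2) ^ ((2 : ℕ)⁻¹ : ℂ)) ^ 2 = x ^ 2 - 1 := by
          intro x
          rw [mul_pow, hsq, Complex.I_sq]; ring
        have hd : DifferentiableAt ℂ (fun x : ℂ => Complex.cos (2 * t * Complex.log
            (x + Complex.I * (1 - x ^ 2) ^ ((2 : ℕ)⁻¹ : ℂ)))) y := by
          have := slit_of y _ hy (hs' y)
          fun_prop (disch := assumption)
        refine hd.congr_of_eventuallyEq ?_
        filter_upwards [hopen.mem_nhds hy] with x hx
        refine Gf_eq _ _ _ (slit_of x _ hx (hs' x)) ?_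
        linear_combination hs' x
    · unfold Gf
      have h0 : ContinuousAt (fun x : ℂ => (x ^ 2 - 1) ^ ((2 : ℕ)⁻¹ : ℂ)) 1 := by
        refine ContinuousAt.comp (f := fun x : ℂ => x ^ 2 - 1)
          (g := fun x : ℂ => x ^ ((2 : ℕ)⁻¹ : ℂ)) ?_ (by fun_prop)
        apply Complex.continuousAt_cpow_const_of_re_pos
        · left; simp
        · norm_num
      have := slit_of 1 _ h1mem (hsq (1 ^ 2 - 1))
      have h2 : ContinuousAt (fun x : ℂ => x + (x ^ 2 - 1) ^ ((2 : ℕ)⁻¹ : ℂ)) 1 :=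
        continuousAt_id.add h0
      have h3 := h2.clog this
      exact Complex.continuous_cos.continuousAt.comp (continuousAt_const.mul h3)
  exact key.differentiableAt (hopen.mem_nhds hζ)

/-- The rational function `cosh (φ - i α)` on the disc. -/
noncomputable def Cf (a b : ℝ) (u : ℂ) : ℂ :=
  -1 + ((a + b : ℝ) : ℂ) * (1 - (((a + b) / 2 : ℝ) + ((b - a) / 2 : ℝ) * u)) ^ 2 /
    (((1 - a) * (1 - b) : ℝ) * (((a + b) / 2 : ℝ) + ((b - a) / 2 : ℝ) * u))

lemma v_pos (a b : ℝ) (ha : 0 < a) (hab : a < b) (u : ℂ) (hu : ‖u‖ ≤ 1) :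
    0 < ((((a + b) / 2 : ℝ) : ℂ) + ((b - a) / 2 : ℝ) * u).re := by
  have h := (abs_le.1 (Complex.abs_re_le_norm u)).1
  simp only [Complex.add_re, Complex.ofReal_re, Complex.re_ofReal_mul]
  nlinarith

lemma v_lt (a b : ℝ) (ha : 0 < a) (hab : a < b) (hb : b < 1) (u : ℂ) (hu : ‖u‖ ≤ 1) :
    ‖((((a + b) / 2 : ℝ) : ℂ) + ((b - a) / 2 : ℝ) * u)‖ < 1 := by
  refine (norm_add_le _ _).trans_lt ?_
  rw [norm_mul, Complex.norm_real, Complex.norm_real, Real.norm_of_nonneg (by linarith),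
    Real.norm_of_nonneg (by linarith)]
  nlinarith

lemma Cf_slit (a b : ℝ) (ha : 0 < a) (hab : a < b) (hb : b < 1) (u : ℂ) (hu : ‖u‖ ≤ 1) :
    Cf a b u + 1 ∈ Complex.slitPlane := by
  have h1 := v_pos a b ha hab u hu
  have h2 := v_lt a b ha hab hb u hu
  unfold Cf
  set v : ℂ := (((a + b) / 2 : ℝ) : ℂ) + ((b - a) / 2 : ℝ) * u with hv
  have hv0 : v ≠ 0 := by rintro h; rw [h] at h1; simp at h1
  have hab' : 0 < (1 - a) * (1 - b) := mul_pos (by linarith) (by linarith)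
  have hk : 0 < (a + b) / ((1 - a) * (1 - b)) := by
    have : 0 < a + b := by linarith
    positivity
  have e : -1 + ((a + b : ℝ) : ℂ) * (1 - v) ^ 2 / (((1 - a) * (1 - b) : ℝ) * v) + 1
      = (((a + b) / ((1 - a) * (1 - b)) : ℝ) : ℂ) * (v + v⁻¹ - 2) := by
    have : (((1 - a) * (1 - b) : ℝ) : ℂ) ≠ 0 := by exact_mod_cast hab'.ne'
    rw [Complex.ofReal_div]
    field_simp
    ring
  rw [e, Complex.mem_slitPlane_iff, Complex.re_ofReal_mul, Complex.im_ofReal_mul]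
  have hn : Complex.normSq v < 1 := by
    rw [Complex.normSq_eq_norm_sq]; nlinarith [norm_nonneg v]
  have hn0 : 0 < Complex.normSq v := Complex.normSq_pos.2 hv0
  by_cases him : v.im = 0
  · left
    apply mul_pos hk
    have hvr : v = (v.re : ℂ) := by apply Complex.ext <;> simp [him]
    have hlt : v.re < 1 := (Complex.re_le_norm v).trans_lt h2
    rw [hvr, ← Complex.ofReal_inv]
    simp only [Complex.add_re, Complex.sub_re, Complex.ofReal_re, Complex.re_ofNat]
    have : v.re + v.re⁻¹ - 2 = (1 - v.re) ^ 2 / v.re := by field_simp; ring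
    rw [this]
    have : 0 < 1 - v.re := by linarith
    positivity
  · right
    apply mul_ne_zero hk.ne'
    simp only [Complex.add_im, Complex.sub_im, Complex.inv_im, Complex.im_ofNat]
    have : v.im + -v.im / Complex.normSq v - 0 = v.im * ((Complex.normSq v - 1) / Complex.normSq v) := by
      field_simp; ring
    rw [this]
    exact mul_ne_zero him (div_ne_zero (by linarith) hn0.ne')

lemma Cf_diff (a b : ℝ) (ha : 0 < a) (hab : a < b) (hb : b < 1) (u : ℂ) (hu : ‖u‖ ≤ 1) :
    DifferentiableAt ℂ (Cf a b) u := by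
  have h1 := v_pos a b ha hab u hu
  have hab' : 0 < (1 - a) * (1 - b) := mul_pos (by linarith) (by linarith)
  have : (((1 - a) * (1 - b) : ℝ) : ℂ) * (((a + b) / 2 : ℝ) + ((b - a) / 2 : ℝ) * u) ≠ 0 := by
    apply mul_ne_zero
    · exact_mod_cast hab'.ne'
    · intro h; rw [h] at h1; simp at h1
  unfold Cf
  fun_prop (disch := assumption)

lemma Cf_alg (a b : ℝ) (ha : 0 < a) (hab : a < b) (hb : b < 1) (u z : ℂ) (hu : ‖u‖ ≤ 1)
    (hu0 : u ≠ 0) (hz0 : z ≠ 0)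
    (hz : z = (a ^ 2 + b ^ 2) / 2 + (b ^ 2 - a ^ 2) / 2 * ((u + u⁻¹) / 2)) :
    Cf a b u = ((b - z) * (a - z) - (1 - z) * ((b ^ 2 - a ^ 2) / 2 * ((u - u⁻¹) / 2))) /
      ((1 - a) * (1 - b) * z) := by
  have h1 := v_pos a b ha hab u hu
  have hv : (((a + b) / 2 : ℝ) : ℂ) + ((b - a) / 2 : ℝ) * u ≠ 0 := by
    intro h; rw [h] at h1; simp at h1
  have ha1 : (1 - a : ℂ) ≠ 0 := by exact_mod_cast (by linarith : (1 - a : ℝ) ≠ 0)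
  have hb1 : (1 - b : ℂ) ≠ 0 := by exact_mod_cast (by linarith : (1 - b : ℝ) ≠ 0)
  unfold Cf
  push_cast at hv ⊢
  have hv2 : (a + b : ℂ) + (b - a) * u ≠ 0 := by
    intro h; apply hv; linear_combination h / 2
  have e : (-1 : ℂ) + (a + b) * (1 - ((a + b) / 2 + (b - a) / 2 * u)) ^ 2 /
     ((1 - a) * (1 - b) * ((a + b) / 2 + (b - a) / 2 * u)) = 
     (-((1 - a) * (1 - b) * ((a + b) / 2 + (b - a) / 2 * u)) + (a + b) * (1 - ((a + b) / 2 + (b - a) / 2 * u)) ^ 2) /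
     ((1 - a) * (1 - b) * ((a + b) / 2 + (b - a) / 2 * u)) := by
    have hm := mul_ne_zero (mul_ne_zero ha1 hb1) hv
    generalize (1 - a : ℂ) * (1 - b) * ((a + b) / 2 + (b - a) / 2 * u) = m at hm
    field_simp
  rw [e, div_eq_div_iff (mul_ne_zero (mul_ne_zero ha1 hb1) hv) (mul_ne_zero (mul_ne_zero ha1 hb1) hz0)]
  rw [hz]
  field_simp
  ring

lemma K_eq (T S : ℝ) (hT : 0 < T) (hTS : T < S) (hS : S < 1) (t : ℂ) (θ : ℝ)
    (h0 : 0 < θ) (hpi : θ < Real.pi) :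
    Gf t (Cf (√T) (√S) (Complex.exp (θ * Complex.I))) +
      Gf t (Cf (√T) (√S) (Complex.exp (-(θ * Complex.I)))) =
      2 * Kker S T t ((T + S) / 2 + (S - T) / 2 * Real.cos θ) := by
  have ha : 0 < √T := Real.sqrt_pos.2 hT
  have hab : √T < √S := Real.sqrt_lt_sqrt hT.le hTS
  have hb : √S < 1 := by rw [Real.sqrt_lt' one_pos]; simpa using hS
  have hTa : √T ^ 2 = T := Real.sq_sqrt hT.le
  have hSb : √S ^ 2 = S := Real.sq_sqrt (hT.trans hTS).le
  have hs : 0 < Real.sin θ := Real.sin_pos_of_pos_of_lt_pi h0 hpi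
  have hc1 : Real.cos θ < 1 := by nlinarith [Real.sin_sq_add_cos_sq θ]
  have hc2 : -1 < Real.cos θ := by nlinarith [Real.sin_sq_add_cos_sq θ]
  have hcs := Real.sin_sq_add_cos_sq θ
  unfold Kker
  set a := √T with hadef
  set b := √S with hbdef
  set z := (T + S) / 2 + (S - T) / 2 * Real.cos θ with hz
  have hzT : T < z := by rw [hz]; nlinarith
  have hzS : z < S := by rw [hz]; nlinarith
  have hz0 : 0 < z := hT.trans hzT
  set r := √z with hr
  have hr0 : 0 < r := Real.sqrt_pos.2 hz0
  have hrz : r ^ 2 = z := Real.sq_sqrt hz0.le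
  have har : a < r := Real.sqrt_lt_sqrt hT.le hzT
  have hrb : r < b := Real.sqrt_lt_sqrt hz0.le hzS
  have ha1 : 0 < 1 - a := by linarith
  have hb1 : 0 < 1 - b := by linarith
  set Y := (1 + r) * (r - a) / (2 * (1 - a) * r) with hY
  set x := (S - z) * (1 - z) / ((1 - b) ^ 2 * z) with hx
  have hY0 : 0 ≤ Y := by
    have : 0 < r - a := by linarith
    rw [hY]; positivity
  have hY2 : 1 - 2 * Y = (a - z) / ((1 - a) * r) := by
    rw [hY, ← hrz]; field_simp; ring
  have hY1 : Y < 1 := by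
    rw [hY, div_lt_one (by positivity)]
    nlinarith [mul_pos (by linarith : 0 < a + r) (by linarith : 0 < 1 - r)]
  have hx0 : 0 < x := by
    have : 0 < S - z := by linarith
    have : 0 < 1 - z := by linarith
    rw [hx]; positivity
  have hx1 : √(x + 1) = (b - z) / ((1 - b) * r) := by
    have hbz : 0 ≤ b - z := by nlinarith
    have e : x + 1 = ((b - z) / ((1 - b) * r)) ^ 2 := by
      rw [hx, ← hSb, div_pow, mul_pow, hrz]; field_simp; ring
    rw [e, Real.sqrt_sq (by positivity)]
  set θ' := Real.arcsin √Y with hθ'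
  set φ := Real.log (√(x + 1) + √x) with hφ
  have hsin : Real.sin θ' = √Y :=
    Real.sin_arcsin (by linarith [Real.sqrt_nonneg Y]) (Real.sqrt_le_one.2 hY1.le)
  have hcos : Real.cos θ' = √(1 - Y) := by
    rw [hθ', Real.cos_arcsin, Real.sq_sqrt hY0]
  have hθ0 : 0 ≤ θ' := Real.arcsin_nonneg.2 (Real.sqrt_nonneg _)
  have hθ2 : θ' < Real.pi / 2 := by
    rw [hθ', Real.arcsin_lt_pi_div_two, Real.sqrt_lt' one_pos]; simpa using hY1
  have hcos2 : Real.cos (2 * θ') = (a - z) / ((1 - a) * r) := by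
    rw [Real.cos_two_mul, hcos, Real.sq_sqrt (by linarith), ← hY2]; ring
  have hsin2 : Real.sin (2 * θ') = 2 * √Y * √(1 - Y) := by
    rw [Real.sin_two_mul, hcos, hsin]
  have hpos : 0 < √(x + 1) + √x := by positivity
  have hexp : Real.exp φ = √(x + 1) + √x := Real.exp_log hpos
  have hexpn : Real.exp (-φ) = √(x + 1) - √x := by
    rw [Real.exp_neg, hexp]
    apply inv_eq_of_mul_eq_one_right
    have h1 := Real.sq_sqrt hx0.le
    have h2 := Real.sq_sqrt (by linarith : 0 ≤ x + 1)
    linear_combination h2 - h1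
  have hcosh : Real.cosh φ = (b - z) / ((1 - b) * r) := by
    rw [Real.cosh_eq, hexp, hexpn, ← hx1]; ring
  have hsinh : Real.sinh φ = √x := by
    rw [Real.sinh_eq, hexp, hexpn]; ring
  have hprod : Real.sinh φ * Real.sin (2 * θ') =
      (1 - z) * ((b ^ 2 - a ^ 2) / 2 * Real.sin θ) / ((1 - a) * (1 - b) * z) := by
    have h1z : 0 < 1 - z := by linarith
    have hba : 0 < b ^ 2 - a ^ 2 := by rw [hTa, hSb]; linarith
    rw [hsinh, hsin2]
    rw [← sq_eq_sq₀ (by positivity) (by positivity)]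
    have e1 : (√x * (2 * √Y * √(1 - Y))) ^ 2 = x * (1 - (1 - 2 * Y) ^ 2) := by
      rw [mul_pow, mul_pow, mul_pow, Real.sq_sqrt hx0.le, Real.sq_sqrt hY0,
        Real.sq_sqrt (by linarith)]; ring
    have e2 : 1 - (1 - 2 * Y) ^ 2 = (z - T) * (1 - z) / ((1 - a) ^ 2 * z) := by
      rw [hY2, ← hrz, ← hTa]; field_simp; ring
    have e3 : (S - z) * (z - T) = ((b ^ 2 - a ^ 2) / 2 * Real.sin θ) ^ 2 := by
      rw [hSb, hTa, hz]; linear_combination (- (S - T) ^ 2 / 4) * hcs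
    rw [e1, e2, hx, div_pow, mul_pow (1 - z), ← e3]
    field_simp
  have main : ∀ ε : ℂ, ε * ε = 1 → ∀ u : ℂ, u = Real.cos θ + ε * (Real.sin θ * Complex.I) →
      u⁻¹ = Real.cos θ - ε * (Real.sin θ * Complex.I) → ‖u‖ ≤ 1 → u ≠ 0 →
      Cf a b u = Complex.cosh (φ - ε * ((2 * θ' : ℝ) * Complex.I)) := by
    intro ε hε u hu hui hun hu0
    rw [Cf_alg a b ha hab hb u z hun hu0 (by exact_mod_cast hz0.ne') (by
      rw [hu, ← hu, hui, hu, hz, ← hTa, ← hSb]; push_cast; ring)]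
    rw [hui, hu]
    have hcc : Complex.cosh (ε * ((2 * θ' : ℝ) * Complex.I)) = Real.cos (2 * θ') := by
      rcases mul_self_eq_one_iff.1 hε with rfl | rfl <;>
      simp [Complex.cosh_mul_I]
    have hss : Complex.sinh (ε * ((2 * θ' : ℝ) * Complex.I)) =
        ε * (Real.sin (2 * θ') * Complex.I) := by
      rcases mul_self_eq_one_iff.1 hε with rfl | rfl <;>
      simp [Complex.sinh_mul_I]
    rw [Complex.cosh_sub, hcc, hss, ← Complex.ofReal_cosh, ← Complex.ofReal_sinh]
    have hp : (Real.sinh φ : ℂ) * (Real.sin (2 * θ') : ℝ) =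
      (1 - z) * ((b ^ 2 - a ^ 2) / 2 * (Real.sin θ : ℝ)) / ((1 - a) * (1 - b) * z) := by
      exact_mod_cast hprod
    have hq : (Real.cosh φ : ℂ) * (Real.cos (2 * θ') : ℝ) =
      (b - z) * (a - z) / ((1 - a) * (1 - b) * z) := by
      have : Real.cosh φ * Real.cos (2 * θ') = (b - z) * (a - z) / ((1 - a) * (1 - b) * z) := by
        rw [hcosh, hcos2]
        field_simp
        rw [hrz]
        ring
      exact_mod_cast this
    have e : (Real.sinh φ : ℂ) * (ε * ((Real.sin (2 * θ') : ℝ) * Complex.I)) =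
        ε * Complex.I * ((Real.sinh φ : ℂ) * (Real.sin (2 * θ') : ℝ)) := by ring
    rw [e, hp, hq]
    ring
  have hm1 := main 1 (by norm_num) (Complex.exp (θ * Complex.I))
    (by rw [Complex.exp_mul_I]; push_cast; ring)
    (by rw [← Complex.exp_neg, ← neg_mul, Complex.exp_mul_I]; simp; ring)
    (by rw [Complex.norm_exp_ofReal_mul_I]) (Complex.exp_ne_zero _)
  have hm2 := main (-1) (by norm_num) (Complex.exp (-(θ * Complex.I)))
    (by rw [← neg_mul, Complex.exp_mul_I]; simp)
    (by rw [← Complex.exp_neg, neg_neg, Complex.exp_mul_I]; simp)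
    (by
      have := Complex.norm_exp_ofReal_mul_I (-θ)
      push_cast at this
      rw [← neg_mul, this]) (Complex.exp_ne_zero _)
  rw [hm1, hm2, Gf_cos, Gf_cos]
  · have e1 : 2 * t * (φ - 1 * ((2 * θ' : ℝ) * Complex.I)) =
      2 * t * φ - 4 * Complex.I * t * θ' := by push_cast; ring
    have e2 : 2 * t * (φ - (-1) * ((2 * θ' : ℝ) * Complex.I)) =
      2 * t * φ + 4 * Complex.I * t * θ' := by push_cast; ring
    rw [e1, e2, Complex.cos_sub, Complex.cos_add]
    ring
  all_goals
    simp
    linarith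

lemma circle_part (T S : ℝ) (hT : 0 < T) (hTS : T < S) (hS : S < 1) (t : ℂ) :
    ∫ θ in (0:ℝ)..(2 * Real.pi), Gf t (Cf (√T) (√S) (Complex.exp (θ * Complex.I))) /
      ((1 - ((T + S) / 2 + (S - T) / 2 * Real.cos θ) : ℝ) : ℂ) =
    2 * ((Real.pi : ℂ) / ((√(1 - T) : ℝ) * (√(1 - S) : ℝ))) := by
  have ha : 0 < √T := Real.sqrt_pos.2 hT
  have hab : √T < √S := Real.sqrt_lt_sqrt hT.le hTS
  have hb : √S < 1 := by rw [Real.sqrt_lt' one_pos]; simpa using hS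
  have hTa : √T ^ 2 = T := Real.sq_sqrt hT.le
  have hSb : √S ^ 2 = S := Real.sq_sqrt (hT.trans hTS).le
  set a := √T with hadef
  set b := √S with hbdef
  set n := √(1 - T) with hn
  set m := √(1 - S) with hm
  have hm0 : 0 < m := Real.sqrt_pos.2 (by linarith)
  have hmn : m < n := Real.sqrt_lt_sqrt (by linarith) (by linarith)
  have hm2 : m ^ 2 = 1 - S := Real.sq_sqrt (by linarith)
  have hn2 : n ^ 2 = 1 - T := Real.sq_sqrt (by linarith)
  have hnm1 : 0 < n - m := by linarith
  have hnm2 : 0 < n + m := by linarith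
  set ρ : ℝ := (n - m) / (n + m) with hρ
  set ρ' : ℝ := (n + m) / (n - m) with hρ'
  have hρ0 : 0 < ρ := by positivity
  have hρ1 : ρ < 1 := by rw [hρ, div_lt_one hnm2]; linarith
  have hρ'1 : 1 < ρ' := by rw [hρ', one_lt_div hnm1]; linarith
  have hST : 0 < S - T := by linarith
  have hne : ∀ u : ℂ, ‖u‖ ≤ 1 → u - (ρ' : ℂ) ≠ 0 := by
    intro u hu h
    have : u = (ρ' : ℂ) := by linear_combination h
    rw [this, Complex.norm_real, Real.norm_of_nonneg (by linarith)] at hu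
    linarith
  set f : ℂ → ℂ := fun u => Gf t (Cf a b u) * (-4 / ((S - T : ℝ) * Complex.I * (u - ρ'))) with hf
  have hd : DifferentiableOn ℂ f (Metric.closedBall 0 1) := by
    intro u hu
    have hu' : ‖u‖ ≤ 1 := by simpa using hu
    apply DifferentiableAt.differentiableWithinAt
    have h1 : DifferentiableAt ℂ (fun u => Gf t (Cf a b u)) u :=
      (Gf_diff t _ (Cf_slit a b ha hab hb u hu')).comp u (Cf_diff a b ha hab hb u hu')
    have h2 : ((S - T : ℝ) : ℂ) * Complex.I * (u - ρ') ≠ 0 := by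
      refine mul_ne_zero (mul_ne_zero ?_ Complex.I_ne_zero) (hne u hu')
      exact_mod_cast hST.ne'
    rw [hf]
    fun_prop (disch := assumption)
  have hC := hd.circleIntegral_sub_inv_smul (w := (ρ : ℂ)) (by
    simp [abs_of_pos hρ0, hρ1])
  have hfρ : f ρ = -4 / ((S - T : ℝ) * Complex.I * (ρ - ρ')) := by
    have : Cf a b ρ = 1 := by
      have ha1 : (1 - a : ℂ) ≠ 0 := by exact_mod_cast (by linarith : (1 - a : ℝ) ≠ 0)
      have hb1 : (1 - b : ℂ) ≠ 0 := by exact_mod_cast (by linarith : (1 - b : ℝ) ≠ 0)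
      rw [Cf_alg a b ha hab hb ρ 1 (by rw [Complex.norm_real, Real.norm_of_nonneg hρ0.le]; exact hρ1.le)
        (by exact_mod_cast hρ0.ne') one_ne_zero]
      · field_simp
        ring
      · have : (1 : ℝ) = (a ^ 2 + b ^ 2) / 2 + (b ^ 2 - a ^ 2) / 2 * ((ρ + ρ⁻¹) / 2) := by
          rw [hTa, hSb, hρ]
          have e1 : S = 1 - m ^ 2 := by linarith
          have e2 : T = 1 - n ^ 2 := by linarith
          rw [e1, e2]
          field_simp
          ring
        exact_mod_cast this
    rw [hf]
    simp only [this]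
    have h1 := Gf_cos t 0 (by simp [Real.pi_pos]) (by simp [Real.pi_pos])
    rw [Complex.cosh_zero] at h1
    rw [h1]
    simp
  have hrhs : (2 * Real.pi * Complex.I : ℂ) • f ρ = 2 * ((Real.pi : ℂ) / ((n : ℝ) * (m : ℝ))) := by
    have e : (S - T) * (ρ' - ρ) = 4 * (n * m) := by
      have e1 : S = 1 - m ^ 2 := by linarith
      have e2 : T = 1 - n ^ 2 := by linarith
      rw [e1, e2, hρ, hρ']
      field_simp
      ring
    have e' : ((S - T : ℝ) : ℂ) * Complex.I * (ρ - ρ') = -(4 * (n * m)) * Complex.I := by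
      have : ((S - T : ℝ) : ℂ) * (ρ' - ρ) = 4 * (n * m) := by exact_mod_cast e
      linear_combination (-Complex.I) * this
    have hn0 : (n : ℂ) ≠ 0 := by exact_mod_cast (by linarith : n ≠ 0)
    have hm0' : (m : ℂ) ≠ 0 := by exact_mod_cast hm0.ne'
    rw [hfρ, e', smul_eq_mul]
    field_simp [Complex.I_ne_zero]
  rw [← hrhs, ← hC, circleIntegral]
  apply intervalIntegral.integral_congr
  intro θ _
  simp only [deriv_circleMap, circleMap_zero, Complex.ofReal_one, one_mul, smul_eq_mul, hf]
  have hun : ‖Complex.exp (θ * Complex.I)‖ ≤ 1 := (Complex.norm_exp_ofReal_mul_I θ).le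
  have hun' : ‖Complex.exp (θ * Complex.I)‖ = 1 := (Complex.norm_exp_ofReal_mul_I θ)
  have hu0 : Complex.exp (θ * Complex.I) ≠ 0 := Complex.exp_ne_zero _
  have hcosu : ((Real.cos θ : ℝ) : ℂ) = (Complex.exp (θ * Complex.I) + (Complex.exp (θ * Complex.I))⁻¹) / 2 := by
    rw [← Complex.exp_neg, Complex.ofReal_cos, Complex.cos, neg_mul]
  set u := Complex.exp (θ * Complex.I) with hu
  have hne1 := hne u hun
  have hne2 : u - (ρ : ℂ) ≠ 0 := by
    intro h
    have : u = (ρ : ℂ) := by linear_combination h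
    rw [this, Complex.norm_real, Real.norm_of_nonneg hρ0.le] at hun'
    linarith
  have hSTc : (S : ℂ) - T ≠ 0 := by exact_mod_cast hST.ne'
  have key : ((1 - ((T + S) / 2 + (S - T) / 2 * Real.cos θ) : ℝ) : ℂ) * (4 * u) =
      - (S - T) * ((u - ρ) * (u - ρ')) := by
    push_cast [-Complex.ofReal_cos]
    rw [hcosu]
    have h1 : (ρ : ℂ) * ρ' = 1 := by
      have : ρ * ρ' = 1 := by rw [hρ, hρ']; field_simp
      exact_mod_cast this
    have h2 : ((S : ℂ) - T) * (ρ + ρ') = 4 - 2 * (T + S) := by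
      have : (S - T) * (ρ + ρ') = 4 - 2 * (T + S) := by
        have e1 : S = 1 - m ^ 2 := by linarith
        have e2 : T = 1 - n ^ 2 := by linarith
        rw [e1, e2, hρ, hρ']; field_simp; ring
      exact_mod_cast this
    have h3 : u * u⁻¹ = 1 := mul_inv_cancel₀ hu0
    linear_combination (-(S - T : ℂ)) * h3 + (S - T : ℂ) * h1 - u * h2
  have hz0 : ((1 - ((T + S) / 2 + (S - T) / 2 * Real.cos θ) : ℝ) : ℂ) ≠ 0 := by
    intro h
    rw [h, zero_mul] at key
    exact (mul_ne_zero (neg_ne_zero.2 hSTc) (mul_ne_zero hne2 hne1)) (by linear_combination -key)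
  rw [div_eq_iff hz0]
  generalize ((1 - ((T + S) / 2 + (S - T) / 2 * Real.cos θ) : ℝ) : ℂ) = w at key hz0
  push_cast
  field_simp [Complex.I_ne_zero]
  linear_combination (Gf t (Cf a b u)) * key

theorem stmt_0 (T S : ℝ) (hT : 0 < T) (hTS : T < S) (hS : S < 1) (t : ℂ) :
    Aint S T t = (Real.pi : ℂ) / ((Real.sqrt (1 - T) : ℝ) * (Real.sqrt (1 - S) : ℝ)) := by
  have hST : 0 < S - T := by linarith
  have hcirc := circle_part T S hT hTS hS t
  have ha : 0 < √T := Real.sqrt_pos.2 hT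
  have hab : √T < √S := Real.sqrt_lt_sqrt hT.le hTS
  have hb : √S < 1 := by rw [Real.sqrt_lt' one_pos]; simpa using hS
  set g : ℝ → ℂ := fun θ => Gf t (Cf (√T) (√S) (Complex.exp (θ * Complex.I))) /
      ((1 - ((T + S) / 2 + (S - T) / 2 * Real.cos θ) : ℝ) : ℂ) with hg
  have hz1 : ∀ θ : ℝ, 0 < 1 - ((T + S) / 2 + (S - T) / 2 * Real.cos θ) := by
    intro θ
    nlinarith [Real.cos_le_one θ]
  have hgc : Continuous g := by
    rw [hg]
    refine Continuous.div ?_ (by fun_prop) (fun θ => by exact_mod_cast (hz1 θ).ne')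
    rw [continuous_iff_continuousAt]
    intro θ
    have hun : ‖Complex.exp (θ * Complex.I)‖ ≤ 1 := (Complex.norm_exp_ofReal_mul_I θ).le
    have h1 := (Gf_diff t _ (Cf_slit _ _ ha hab hb _ hun)).continuousAt
    have h2 := (Cf_diff _ _ ha hab hb _ hun).continuousAt
    have h3 : ContinuousAt (fun θ : ℝ => Complex.exp (θ * Complex.I)) θ := by fun_prop
    exact ContinuousAt.comp (f := fun θ : ℝ => Cf (√T) (√S) (Complex.exp (θ * Complex.I))) h1
      (ContinuousAt.comp (f := fun θ : ℝ => Complex.exp (θ * Complex.I)) h2 h3)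
  have hsplit : ∫ θ in (0:ℝ)..(2 * Real.pi), g θ =
      ∫ θ in (0:ℝ)..Real.pi, (g θ + g (2 * Real.pi - θ)) := by
    have hgc2 : Continuous fun θ : ℝ => g (2 * Real.pi - θ) := hgc.comp (by fun_prop)
    rw [intervalIntegral.integral_add (hgc.intervalIntegrable _ _) (hgc2.intervalIntegrable _ _),
      intervalIntegral.integral_comp_sub_left (fun θ => g θ)]
    rw [show 2 * Real.pi - Real.pi = Real.pi by ring, sub_zero,
      intervalIntegral.integral_add_adjacent_intervals (hgc.intervalIntegrable _ _)
        (hgc.intervalIntegrable _ _)]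
  have himg : (fun θ : ℝ => (T + S) / 2 + (S - T) / 2 * Real.cos θ) '' Set.Ioo 0 Real.pi =
      Set.Ioo T S := by
    ext z
    constructor
    · rintro ⟨θ, ⟨h0, hpi⟩, rfl⟩
      have hs : 0 < Real.sin θ := Real.sin_pos_of_pos_of_lt_pi h0 hpi
      have hc1 : Real.cos θ < 1 := by nlinarith [Real.sin_sq_add_cos_sq θ]
      have hc2 : -1 < Real.cos θ := by nlinarith [Real.sin_sq_add_cos_sq θ]
      constructor <;> simp only <;> nlinarith
    · rintro ⟨h1, h2⟩
      have hl : -1 < (z - (T + S) / 2) / ((S - T) / 2) := by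
        rw [lt_div_iff₀ (by linarith)]; linarith
      have hr : (z - (T + S) / 2) / ((S - T) / 2) < 1 := by
        rw [div_lt_iff₀ (by linarith)]; linarith
      refine ⟨Real.arccos ((z - (T + S) / 2) / ((S - T) / 2)), ⟨Real.arccos_pos.2 hr, ?_⟩, ?_⟩
      · refine lt_of_le_of_ne (Real.arccos_le_pi _) ?_
        rw [Ne, Real.arccos_eq_pi]
        linarith
      · simp only
        rw [Real.cos_arccos hl.le hr.le]
        field_simp
        ring
  have hsub : Aint S T t = ∫ θ in (0:ℝ)..Real.pi, (1 / 2 : ℂ) * (g θ + g (2 * Real.pi - θ)) := by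
    unfold Aint
    rw [intervalIntegral.integral_of_le hTS.le, intervalIntegral.integral_of_le Real.pi_pos.le,
      integral_Ioc_eq_integral_Ioo, integral_Ioc_eq_integral_Ioo, ← himg]
    rw [integral_image_eq_integral_abs_deriv_smul (f' := fun θ => (S - T) / 2 * (-Real.sin θ))
      measurableSet_Ioo]
    · apply setIntegral_congr_fun measurableSet_Ioo
      rintro θ ⟨h0, hpi⟩
      have hs : 0 < Real.sin θ := Real.sin_pos_of_pos_of_lt_pi h0 hpi
      have hK := K_eq T S hT hTS hS t θ h0 hpi
      have hg2 : g (2 * Real.pi - θ) = Gf t (Cf (√T) (√S) (Complex.exp (-(θ * Complex.I)))) /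
          ((1 - ((T + S) / 2 + (S - T) / 2 * Real.cos θ) : ℝ) : ℂ) := by
        rw [hg]
        simp only [Real.cos_two_pi_sub]
        congr 3
        push_cast
        rw [sub_mul, sub_eq_add_neg, Complex.exp_add, Complex.exp_two_pi_mul_I, one_mul]
      simp only
      rw [hg2, hg]
      simp only
      rw [← add_div, hK]
      set z := (T + S) / 2 + (S - T) / 2 * Real.cos θ with hz
      have h1z := hz1 θ
      have hzT : 0 < z - T := by
        have : -1 < Real.cos θ := by nlinarith [Real.sin_sq_add_cos_sq θ]
        rw [hz]; nlinarith
      have hzS : 0 < S - z := by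
        have : Real.cos θ < 1 := by nlinarith [Real.sin_sq_add_cos_sq θ]
        rw [hz]; nlinarith
      have habs : |(S - T) / 2 * (-Real.sin θ)| = √(z - T) * √(S - z) := by
        rw [mul_neg, abs_neg, abs_of_pos (by positivity), ← Real.sqrt_mul hzT.le]
        symm
        rw [Real.sqrt_eq_iff_mul_self_eq (by positivity) (by positivity), hz]
        linear_combination -(S - T) ^ 2 / 4 * Real.sin_sq_add_cos_sq θ
      rw [habs]
      have n1 : ((√(z - T) : ℝ) : ℂ) ≠ 0 := by exact_mod_cast (Real.sqrt_pos.2 hzT).ne'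
      have n2 : ((√(S - z) : ℝ) : ℂ) ≠ 0 := by exact_mod_cast (Real.sqrt_pos.2 hzS).ne'
      have n3 : ((1 - z : ℝ) : ℂ) ≠ 0 := by exact_mod_cast h1z.ne'
      rw [Complex.real_smul, Complex.ofReal_mul]
      field_simp
    · intro θ _
      exact (((Real.hasDerivAt_cos θ).const_mul _).const_add _).hasDerivWithinAt
    · intro x hx y hy hxy
      simp only at hxy
      apply Real.injOn_cos (Set.Ioo_subset_Icc_self hx) (Set.Ioo_subset_Icc_self hy)
      have : (S - T) / 2 * (Real.cos x - Real.cos y) = 0 := by linear_combination hxy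
      rcases mul_eq_zero.1 this with h | h <;> linarith
  rw [hsub, intervalIntegral.integral_const_mul, ← hsplit, hcirc]
  ring
end

section
/- For every complex number t and all real numbers x > 0 and y > 0, one has 2·cos(2t·L(x))·cos(2t·L(y)) = cos(2t·L(X₊)) + cos(2t·L(X₋)), where L(u) = log(√(u+1)+√u) and X₊ = (√x·√(y+1)+√y·√(x+1))², X₋ = (√x·√(y+1)−√y·√(x+1))², and cos is the complex cosine. -/
/-- `L(u) = log(√(u+1)+√u)`. -/
noncomputable def Lfun (u : ℝ) : ℝ := Real.log (Real.sqrt (u + 1) + Real.sqrt u)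

theorem Lfun_sq (s : ℝ) : Lfun (s ^ 2) = Real.arsinh |s| := by
  unfold Lfun Real.arsinh
  rw [Real.sqrt_sq_eq_abs, sq_abs, add_comm |s|, add_comm (1 : ℝ)]

theorem cos_Lfun_sinh (t : ℂ) (c : ℝ) :
    Complex.cos (2 * t * (Lfun (Real.sinh c ^ 2) : ℝ)) = Complex.cos (2 * t * (c : ℝ)) := by
  rw [Lfun_sq]
  rcases abs_choice (Real.sinh c) with h | h
  · rw [h, Real.arsinh_sinh]
  · rw [h, Real.arsinh_neg, Real.arsinh_sinh, Complex.ofReal_neg, mul_neg, Complex.cos_neg]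

theorem stmt_3 (t : ℂ) (x y : ℝ) (hx : 0 < x) (hy : 0 < y) :
    2 * Complex.cos (2 * t * (Lfun x : ℝ)) * Complex.cos (2 * t * (Lfun y : ℝ)) =
      Complex.cos (2 * t *
          (Lfun ((Real.sqrt x * Real.sqrt (y + 1) + Real.sqrt y * Real.sqrt (x + 1)) ^ 2) : ℝ)) +
      Complex.cos (2 * t *
          (Lfun ((Real.sqrt x * Real.sqrt (y + 1) - Real.sqrt y * Real.sqrt (x + 1)) ^ 2) : ℝ)) := by
  obtain ⟨a, ha⟩ := Real.sinh_surjective (Real.sqrt x)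
  obtain ⟨b, hb⟩ := Real.sinh_surjective (Real.sqrt y)
  have hxa : x = Real.sinh a ^ 2 := by rw [ha, Real.sq_sqrt hx.le]
  have hyb : y = Real.sinh b ^ 2 := by rw [hb, Real.sq_sqrt hy.le]
  have hca : Real.sqrt (x + 1) = Real.cosh a := by
    rw [hxa, ← Real.cosh_sq, Real.sqrt_sq (Real.cosh_pos a).le]
  have hcb : Real.sqrt (y + 1) = Real.cosh b := by
    rw [hyb, ← Real.cosh_sq, Real.sqrt_sq (Real.cosh_pos b).le]
  have hp : Real.sinh a * Real.cosh b + Real.sinh b * Real.cosh a = Real.sinh (a + b) := by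
    rw [Real.sinh_add]; ring
  have hm : Real.sinh a * Real.cosh b - Real.sinh b * Real.cosh a = Real.sinh (a - b) := by
    rw [Real.sinh_sub]; ring
  rw [hca, hcb, ← ha, ← hb, hp, hm, cos_Lfun_sinh, cos_Lfun_sinh, hxa, hyb, cos_Lfun_sinh,
    cos_Lfun_sinh]
  push_cast
  rw [mul_add, mul_sub, Complex.cos_add, Complex.cos_sub]
  ring
end

section
/- For all real numbers x ≥ 0 and y ≥ 0, setting X = (√x·√(y+1)+√y·√(x+1))², one has √(X+1)+√X = (√(x+1)+√x)·(√(y+1)+√y). -/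
theorem stmt_4 (x y : ℝ) (hx : 0 ≤ x) (hy : 0 ≤ y) :
    let X := (Real.sqrt x * Real.sqrt (y + 1) + Real.sqrt y * Real.sqrt (x + 1)) ^ 2
    Real.sqrt (X + 1) + Real.sqrt X =
      (Real.sqrt (x + 1) + Real.sqrt x) * (Real.sqrt (y + 1) + Real.sqrt y) := by
  intro X
  have ha : Real.sqrt (x + 1) ^ 2 - Real.sqrt x ^ 2 = 1 := by
    rw [Real.sq_sqrt (by linarith), Real.sq_sqrt hx]; ring
  have hb : Real.sqrt (y + 1) ^ 2 - Real.sqrt y ^ 2 = 1 := by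
    rw [Real.sq_sqrt (by linarith), Real.sq_sqrt hy]; ring
  have h1 : X + 1 =
      (Real.sqrt (x + 1) * Real.sqrt (y + 1) + Real.sqrt x * Real.sqrt y) ^ 2 := by
    simp only [X]
    linear_combination -(Real.sqrt (y + 1) ^ 2 - Real.sqrt y ^ 2) * ha - hb
  rw [h1, Real.sqrt_sq (by positivity)]
  simp only [X]
  rw [Real.sqrt_sq (by positivity)]
  ring
end

section
/- Let A > −1 and r > 0 be real numbers. Then (1/(2π))·∫_0^∞ [Γ(is)·Γ(−is)·(Γ(1/2+is)·Γ(1/2−is))²/(Γ(2is)·Γ(−2is))]·(1+r)^{−1/2}·cos(2s·log(√(r+1)+√r))·φ_A(s) ds = π·(1+A)^{1/2}/(1+r+A). -/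
open MeasureTheory

/-- Closed form of the hypergeometric value `F(is,−is;1/2;−A)` for `A > −1`:
`cos(2s·log(√(A+1)+√A))` when `A ≥ 0`, and `cosh(2s·arcsin√(−A))` when `−1 < A < 0`. -/
noncomputable def phiF (A s : ℝ) : ℝ :=
  if 0 ≤ A then Real.cos (2 * s * Real.log (Real.sqrt (A + 1) + Real.sqrt A))
  else Real.cosh (2 * s * Real.arcsin (Real.sqrt (-A)))

lemma aux_sig (s : ℝ) : Real.sigmoid (2 * Real.pi * s) =
    Real.exp (Real.pi * s - Real.log (2 * Real.cosh (Real.pi * s))) := by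
  have hc := Real.cosh_pos (Real.pi * s)
  rw [Real.exp_sub, Real.exp_log (by positivity), Real.sigmoid_def, Real.cosh_eq]
  have h1 : Real.exp (-(2 * Real.pi * s)) = Real.exp (-(Real.pi * s)) * Real.exp (-(Real.pi * s)) := by
    rw [← Real.exp_add]; congr 1; ring
  have h2 : Real.exp (Real.pi * s) * Real.exp (-(Real.pi * s)) = 1 := by
    rw [← Real.exp_add]; simp
  rw [h1]
  have h3 := Real.exp_pos (Real.pi * s)
  have h4 := Real.exp_pos (-(Real.pi * s))
  field_simp
  linear_combination (-Real.exp (-(Real.pi * s))) * h2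

lemma aux_sig' (s : ℝ) : 1 - Real.sigmoid (2 * Real.pi * s) =
    Real.exp (-(Real.pi * s) - Real.log (2 * Real.cosh (Real.pi * s))) := by
  rw [← Real.sigmoid_neg]
  have := aux_sig (-s)
  simpa using this

lemma aux_pt (z : ℂ) (s : ℝ) :
    |2 * Real.pi * (Real.sigmoid (2 * Real.pi * s) * (1 - Real.sigmoid (2 * Real.pi * s)))| •
      (((Real.sigmoid (2 * Real.pi * s) : ℝ) : ℂ) ^ ((1 / 2 + z / (2 * Real.pi)) - 1) *
        (1 - ((Real.sigmoid (2 * Real.pi * s) : ℝ) : ℂ)) ^ ((1 / 2 - z / (2 * Real.pi)) - 1))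
      = Real.pi * (Complex.exp (z * s) / Complex.cosh (Real.pi * s)) := by
  have hc := Real.cosh_pos (Real.pi * s)
  have h1 : (1 - ((Real.sigmoid (2 * Real.pi * s) : ℝ) : ℂ)) =
    ((1 - Real.sigmoid (2 * Real.pi * s) : ℝ) : ℂ) := by push_cast; rfl
  rw [h1, aux_sig', aux_sig, abs_of_pos (by positivity)]
  have hL : (Real.cosh (Real.pi * s)) =
      Real.exp (Real.log (2 * Real.cosh (Real.pi * s))) / 2 := by
    rw [Real.exp_log (by positivity)]; ring
  have hL' : Complex.cosh (Real.pi * s) =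
      Complex.exp (Real.log (2 * Real.cosh (Real.pi * s))) / 2 := by
    have := congrArg (fun x : ℝ => (x : ℂ)) hL
    simpa only [Complex.ofReal_cosh, Complex.ofReal_mul, Complex.ofReal_div, Complex.ofReal_exp,
      Complex.ofReal_ofNat] using this
  rw [hL']
  generalize Real.log (2 * Real.cosh (Real.pi * s)) = L
  rw [Complex.cpow_def_of_ne_zero (by exact_mod_cast (Real.exp_pos _).ne'),
    Complex.cpow_def_of_ne_zero (by exact_mod_cast (Real.exp_pos _).ne'),
    ← Complex.ofReal_log (Real.exp_pos _).le, ← Complex.ofReal_log (Real.exp_pos _).le,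
    Real.log_exp, Real.log_exp, Complex.real_smul]
  push_cast
  have hpi : (Real.pi : ℂ) ≠ 0 := by exact_mod_cast Real.pi_ne_zero
  have : ∀ a b c d : ℂ, 2 * (Real.pi : ℂ) * (Complex.exp a * Complex.exp b) *
    (Complex.exp c * Complex.exp d) = 2 * (Real.pi : ℂ) * Complex.exp (a + b + c + d) := by
    intro a b c d; simp only [Complex.exp_add]; ring
  rw [this, div_div_eq_mul_div, mul_div_right_comm, ← Complex.exp_sub]
  rw [show ∀ w : ℂ, (Real.pi : ℂ) * (w * 2) = 2 * Real.pi * w by intro w; ring]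
  congr 2
  field_simp
  ring

lemma aux_key (z : ℂ) (h1 : -Real.pi < z.re) (h2 : z.re < Real.pi) :
    Integrable (fun s : ℝ => Complex.exp (z * s) / Complex.cosh (Real.pi * s)) ∧
    ∫ s : ℝ, Complex.exp (z * s) / Complex.cosh (Real.pi * s) = 1 / Complex.cos (z / 2) := by
  have hpi : (Real.pi : ℂ) ≠ 0 := by exact_mod_cast Real.pi_ne_zero
  have hp := Real.pi_pos
  have hre : (z / (2 * Real.pi)).re = z.re / (2 * Real.pi) := by
    rw [show (2 * Real.pi : ℂ) = ((2 * Real.pi : ℝ) : ℂ) by push_cast; rfl, Complex.div_ofReal_re]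
  have ha : -(1/2) < z.re / (2 * Real.pi) := by
    rw [lt_div_iff₀ (by positivity)]; linarith
  have hb : z.re / (2 * Real.pi) < 1/2 := by
    rw [div_lt_iff₀ (by positivity)]; linarith
  have hu : 0 < (1 / 2 + z / (2 * Real.pi) : ℂ).re := by
    rw [Complex.add_re, hre]; norm_num; linarith
  have hv : 0 < (1 / 2 - z / (2 * Real.pi) : ℂ).re := by
    rw [Complex.sub_re, hre]; norm_num; linarith
  have hi := Complex.betaIntegral_convergent hu hv
  have hB := Complex.betaIntegral_eq_Gamma_mul_div _ _ hu hv
  rw [intervalIntegrable_iff_integrableOn_Ioo_of_le zero_le_one] at hi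
  rw [show (1 / 2 - z / (2 * Real.pi) : ℂ) = 1 - (1 / 2 + z / (2 * Real.pi)) by ring,
    Complex.Gamma_mul_Gamma_one_sub,
    show (1 - (1 / 2 + z / (2 * Real.pi)) : ℂ) = 1 / 2 - z / (2 * Real.pi) by ring,
    show (1 / 2 + z / (2 * Real.pi) + (1 / 2 - z / (2 * Real.pi)) : ℂ) = 1 by ring,
    Complex.Gamma_one, div_one, Complex.betaIntegral,
    intervalIntegral.integral_of_le zero_le_one, integral_Ioc_eq_integral_Ioo] at hB
  have himg : (fun s : ℝ => Real.sigmoid (2 * Real.pi * s)) '' Set.univ = Set.Ioo 0 1 := by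
    rw [← Real.range_sigmoid, Set.image_univ]
    ext x
    constructor
    · rintro ⟨y, rfl⟩; exact ⟨_, rfl⟩
    · rintro ⟨y, rfl⟩
      refine ⟨y / (2 * Real.pi), ?_⟩
      simp only
      congr 1
      field_simp
  have hd : ∀ x ∈ (Set.univ : Set ℝ), HasDerivWithinAt
      (fun s : ℝ => Real.sigmoid (2 * Real.pi * s))
      (2 * Real.pi * (Real.sigmoid (2 * Real.pi * x) * (1 - Real.sigmoid (2 * Real.pi * x))))
      Set.univ x := by
    intro x _
    have h := (Real.hasDerivAt_sigmoid (2 * Real.pi * x)).comp x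
      ((hasDerivAt_id x).const_mul (2 * Real.pi))
    refine HasDerivAt.hasDerivWithinAt (h.congr_deriv ?_)
    ring
  have hinj : Set.InjOn (fun s : ℝ => Real.sigmoid (2 * Real.pi * s)) Set.univ := by
    intro x _ y _ hxy
    have := Real.sigmoid_injective hxy
    exact mul_left_cancel₀ (by positivity) this
  rw [← himg] at hi hB
  rw [integrableOn_image_iff_integrableOn_abs_deriv_smul MeasurableSet.univ hd hinj] at hi
  rw [integral_image_eq_integral_abs_deriv_smul MeasurableSet.univ hd hinj] at hB
  simp only [aux_pt, integrableOn_univ, Measure.restrict_univ] at hi hB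
  refine ⟨?_, ?_⟩
  · have := hi.const_mul (Real.pi : ℂ)⁻¹
    simpa [hpi] using this
  · rw [integral_const_mul] at hB
    have : (Real.pi : ℂ) * (1 / 2 + z / (2 * Real.pi)) = z / 2 + Real.pi / 2 := by
      field_simp; ring
    rw [this, Complex.sin_add_pi_div_two] at hB
    apply mul_left_cancel₀ hpi
    rw [hB]; ring

lemma aux_cos (a : ℝ) (c : ℂ) (h1 : -(Real.pi / 2) < c.im) (h2 : c.im < Real.pi / 2)
    (hne : Complex.cosh a ^ 2 + Complex.sinh c ^ 2 ≠ 0) :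
    ∫ s in Set.Ioi (0 : ℝ), Complex.cos (2 * s * a) * Complex.cos (2 * s * c) /
      Complex.cosh (Real.pi * s) =
      Complex.cosh a * Complex.cosh c / (2 * (Complex.cosh a ^ 2 + Complex.sinh c ^ 2)) := by
  obtain ⟨i1, e1⟩ := aux_key (2 * Complex.I * (a + c)) (by simp; linarith) (by simp; linarith)
  obtain ⟨i2, e2⟩ := aux_key (2 * Complex.I * (a - c)) (by simp; linarith) (by simp; linarith)
  obtain ⟨i3, e3⟩ := aux_key (2 * Complex.I * (-a + c)) (by simp; linarith) (by simp; linarith)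
  obtain ⟨i4, e4⟩ := aux_key (2 * Complex.I * (-a - c)) (by simp; linarith) (by simp; linarith)
  have hcos : ∀ w : ℂ, Complex.cos (2 * Complex.I * w / 2) = Complex.cosh w := by
    intro w
    rw [← Complex.cos_mul_I]; congr 1; ring
  rw [hcos] at e1 e2 e3 e4
  set F : ℝ → ℂ := fun s => Complex.cos (2 * s * a) * Complex.cos (2 * s * c) /
      Complex.cosh (Real.pi * s) with hF
  have hexp : ∀ s : ℝ, F s = (1 / 4) * (Complex.exp (2 * Complex.I * (a + c) * s) / Complex.cosh (Real.pi * s)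
     + Complex.exp (2 * Complex.I * (a - c) * s) / Complex.cosh (Real.pi * s)
     + Complex.exp (2 * Complex.I * (-a + c) * s) / Complex.cosh (Real.pi * s)
     + Complex.exp (2 * Complex.I * (-a - c) * s) / Complex.cosh (Real.pi * s)) := by
    intro s
    simp only [hF, Complex.cos]
    rw [show 2 * Complex.I * (a + c) * s = 2 * s * a * Complex.I + 2 * s * c * Complex.I by ring,
      show 2 * Complex.I * (a - c) * s = 2 * s * a * Complex.I + -(2 * s * c) * Complex.I by ring,
      show 2 * Complex.I * (-a + c) * s = -(2 * s * a) * Complex.I + 2 * s * c * Complex.I by ring,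
      show 2 * Complex.I * (-a - c) * s = -(2 * s * a) * Complex.I + -(2 * s * c) * Complex.I by ring]
    simp only [Complex.exp_add]
    ring
  have hFi : Integrable F := by
    have := (((i1.add i2).add i3).add i4).const_mul (1 / 4 : ℂ)
    exact this.congr (Filter.Eventually.of_forall fun s => (hexp s).symm)
  have hFe : ∀ s : ℝ, F (-s) = F s := by
    intro s
    simp [hF]
  have hfull : ∫ s, F s = 2 * ∫ s in Set.Ioi (0 : ℝ), F s := by
    have h1 := intervalIntegral.integral_Iic_add_Ioi (b := (0 : ℝ)) hFi.integrableOn hFi.integrableOn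
    have h2 := integral_comp_neg_Iic (0 : ℝ) F
    simp only [hFe, neg_zero] at h2
    rw [← h1, h2, two_mul]
  have hval : ∫ s, F s = (1 / 4) * (1 / Complex.cosh (a + c) + 1 / Complex.cosh (a - c)
      + 1 / Complex.cosh (-a + c) + 1 / Complex.cosh (-a - c)) := by
    simp only [hexp]
    rw [integral_const_mul, integral_add, integral_add, integral_add, e1, e2, e3, e4]
    · exact i1
    · exact i2
    · exact i1.add i2
    · exact i3
    · exact (i1.add i2).add i3
    · exact i4
  have hprod : Complex.cosh (a + c) * Complex.cosh (a - c) =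
      Complex.cosh a ^ 2 + Complex.sinh c ^ 2 := by
    rw [Complex.cosh_add, Complex.cosh_sub]
    linear_combination Complex.cosh a ^ 2 * Complex.cosh_sq_sub_sinh_sq c
      + Complex.sinh c ^ 2 * Complex.cosh_sq_sub_sinh_sq a
  have hsum : Complex.cosh (a + c) + Complex.cosh (a - c) = 2 * Complex.cosh a * Complex.cosh c := by
    rw [Complex.cosh_add, Complex.cosh_sub]; ring
  have n1 : Complex.cosh (a + c) ≠ 0 := by
    intro h; rw [h, zero_mul] at hprod; exact hne hprod.symm
  have n2 : Complex.cosh (a - c) ≠ 0 := by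
    intro h; rw [h, mul_zero] at hprod; exact hne hprod.symm
  rw [show -(a : ℂ) + c = -(a - c) by ring, show -(a : ℂ) - c = -(a + c) by ring,
    Complex.cosh_neg, Complex.cosh_neg, hfull] at hval
  have : ∫ s in Set.Ioi (0 : ℝ), F s = (1 / 4) * (1 / Complex.cosh (a + c) + 1 / Complex.cosh (a - c)) := by
    linear_combination hval / 2
  rw [this, div_add_div _ _ n1 n2, hprod, one_mul, mul_one, add_comm, hsum]
  field_simp
  norm_num

lemma aux_gamma (s : ℝ) (hs : 0 < s) :
    (Complex.Gamma (Complex.I * s) * Complex.Gamma (-(Complex.I * s)) *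
          (Complex.Gamma (1 / 2 + Complex.I * s) * Complex.Gamma (1 / 2 - Complex.I * s)) ^ 2 /
          (Complex.Gamma (2 * Complex.I * s) * Complex.Gamma (-(2 * Complex.I * s)))) =
      4 * Real.pi ^ 2 / Complex.cosh (Real.pi * s) := by
  have hpi : (Real.pi : ℂ) ≠ 0 := by exact_mod_cast Real.pi_ne_zero
  have hG : ∀ w : ℂ, w ≠ 0 → Complex.Gamma w * Complex.Gamma (-w) =
      - Real.pi / (w * Complex.sin (Real.pi * w)) := by
    intro w hw
    have h1 := Complex.Gamma_mul_Gamma_one_sub w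
    rw [show (1 : ℂ) - w = -w + 1 by ring, Complex.Gamma_add_one _ (neg_ne_zero.mpr hw)] at h1
    have : Complex.Gamma w * Complex.Gamma (-w) = -(1 / w) *
      (Complex.Gamma w * (-w * Complex.Gamma (-w))) := by field_simp
    rw [this, h1]
    simp only [div_eq_mul_inv, mul_inv]; ring
  have hs0 : (s : ℂ) ≠ 0 := by exact_mod_cast hs.ne'
  have hhalf : Complex.Gamma (1 / 2 + Complex.I * s) * Complex.Gamma (1 / 2 - Complex.I * s) =
      Real.pi / Complex.cosh (Real.pi * s) := by
    rw [show (1 / 2 - Complex.I * s : ℂ) = 1 - (1 / 2 + Complex.I * s) by ring,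
      Complex.Gamma_mul_Gamma_one_sub,
      show (Real.pi : ℂ) * (1 / 2 + Complex.I * s) = Real.pi * s * Complex.I + Real.pi / 2 by ring,
      Complex.sin_add_pi_div_two, Complex.cos_mul_I]
  have hc : Complex.cosh (Real.pi * s) ≠ 0 := by
    have := (Real.cosh_pos (Real.pi * s)).ne'
    exact_mod_cast this
  have hsh : Complex.sinh (Real.pi * s) ≠ 0 := by
    have := (Real.sinh_pos_iff.mpr (mul_pos Real.pi_pos hs)).ne'
    exact_mod_cast this
  rw [hhalf, hG _ (by simp [hs0]), hG _ (by simp [hs0]),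
    show (Real.pi : ℂ) * (Complex.I * s) = Real.pi * s * Complex.I by ring,
    show (Real.pi : ℂ) * (2 * Complex.I * s) = 2 * (Real.pi * s) * Complex.I by ring,
    Complex.sin_mul_I, Complex.sin_mul_I, Complex.sinh_two_mul]
  field_simp
  try norm_num

lemma aux_log {x : ℝ} (hx : 0 ≤ x) :
    Real.log (Real.sqrt (x + 1) + Real.sqrt x) = Real.arsinh (Real.sqrt x) := by
  rw [Real.arsinh, Real.sq_sqrt hx]
  congr 1
  rw [add_comm, add_comm x 1]

lemma aux_cosh {x : ℝ} (hx : 0 ≤ x) :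
    Real.cosh (Real.log (Real.sqrt (x + 1) + Real.sqrt x)) = Real.sqrt (1 + x) := by
  rw [aux_log hx, Real.cosh_arsinh, Real.sq_sqrt hx]

lemma aux_sinh {x : ℝ} (hx : 0 ≤ x) :
    Real.sinh (Real.log (Real.sqrt (x + 1) + Real.sqrt x)) = Real.sqrt x := by
  rw [aux_log hx, Real.sinh_arsinh]

lemma aux_phi (A : ℝ) (hA : -1 < A) : ∃ c : ℂ, -(Real.pi / 2) < c.im ∧ c.im < Real.pi / 2 ∧
    Complex.sinh c ^ 2 = A ∧ Complex.cosh c = (Real.sqrt (1 + A) : ℝ) ∧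
    ∀ s : ℝ, ((phiF A s : ℝ) : ℂ) = Complex.cos (2 * s * c) := by
  have hp := Real.pi_pos
  by_cases h : 0 ≤ A
  · refine ⟨(Real.log (Real.sqrt (A + 1) + Real.sqrt A) : ℝ), ?_, ?_, ?_, ?_, ?_⟩
    · rw [Complex.ofReal_im]; linarith
    · rw [Complex.ofReal_im]; linarith
    · rw [← Complex.ofReal_sinh, aux_sinh h, ← Complex.ofReal_pow, Real.sq_sqrt h]
    · rw [← Complex.ofReal_cosh, aux_cosh h]
    · intro s
      rw [phiF, if_pos h]
      push_cast; rfl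
  · push Not at h
    have hs : Real.sqrt (-A) < 1 := by
      rw [Real.sqrt_lt' one_pos]; linarith
    have hs0 : 0 ≤ Real.sqrt (-A) := Real.sqrt_nonneg _
    have hsin : Real.sin (Real.arcsin (Real.sqrt (-A))) = Real.sqrt (-A) :=
      Real.sin_arcsin (by linarith) hs.le
    have hcos : Real.cos (Real.arcsin (Real.sqrt (-A))) = Real.sqrt (1 + A) := by
      rw [Real.cos_arcsin, Real.sq_sqrt (by linarith)]; congr 1; ring
    refine ⟨(Real.arcsin (Real.sqrt (-A)) : ℝ) * Complex.I, ?_, ?_, ?_, ?_, ?_⟩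
    · rw [Complex.im_ofReal_mul, Complex.I_im, mul_one]
      have := Real.arcsin_nonneg.mpr hs0
      linarith
    · rw [Complex.im_ofReal_mul, Complex.I_im, mul_one]
      exact Real.arcsin_lt_pi_div_two.mpr hs
    · rw [Complex.sinh_mul_I, ← Complex.ofReal_sin, hsin, mul_pow, Complex.I_sq,
        ← Complex.ofReal_pow, Real.sq_sqrt (by linarith)]
      push_cast; ring
    · rw [Complex.cosh_mul_I, ← Complex.ofReal_cos, hcos]
    · intro s
      rw [phiF, if_neg (not_le.mpr h), ← mul_assoc, Complex.cos_mul_I]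
      push_cast; rfl

theorem stmt_7 (A r : ℝ) (hA : -1 < A) (hr : 0 < r) :
    (1 / (2 * Real.pi) : ℂ) *
      ∫ s in Set.Ioi (0 : ℝ),
        (Complex.Gamma (Complex.I * s) * Complex.Gamma (-(Complex.I * s)) *
          (Complex.Gamma (1 / 2 + Complex.I * s) * Complex.Gamma (1 / 2 - Complex.I * s)) ^ 2 /
          (Complex.Gamma (2 * Complex.I * s) * Complex.Gamma (-(2 * Complex.I * s)))) *
        (((1 + r) ^ (-(1 / 2 : ℝ)) : ℝ) : ℂ) *
        (Real.cos (2 * s * Real.log (Real.sqrt (r + 1) + Real.sqrt r)) : ℝ) *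
        (phiF A s : ℝ) =
    (Real.pi : ℂ) * (((1 + A) ^ ((1 / 2 : ℝ)) : ℝ) : ℂ) / ((1 + r + A : ℝ) : ℂ) := by
  obtain ⟨c, hc1, hc2, hsh, hch, hphi⟩ := aux_phi A hA
  set a : ℝ := Real.log (Real.sqrt (r + 1) + Real.sqrt r) with ha
  have hca : Complex.cosh a = (Real.sqrt (1 + r) : ℝ) := by
    rw [← Complex.ofReal_cosh, aux_cosh hr.le]
  have hden : Complex.cosh a ^ 2 + Complex.sinh c ^ 2 = ((1 + r + A : ℝ) : ℂ) := by
    rw [hca, hsh, ← Complex.ofReal_pow, Real.sq_sqrt (by linarith)]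
    push_cast; rfl
  have hpos : (0 : ℝ) < 1 + r + A := by linarith
  have hne : ((1 + r + A : ℝ) : ℂ) ≠ 0 := by exact_mod_cast hpos.ne'
  have key := aux_cos a c hc1 hc2 (by rw [hden]; exact hne)
  have hR : (1 + r) ^ (-(1 / 2 : ℝ)) = (Real.sqrt (1 + r))⁻¹ := by
    rw [Real.rpow_neg (by linarith), Real.sqrt_eq_rpow]
  rw [hR, ← Real.sqrt_eq_rpow]
  rw [setIntegral_congr_fun (g := fun s : ℝ =>
    (4 * Real.pi ^ 2 * ((Real.sqrt (1 + r))⁻¹ : ℝ) : ℂ) *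
      (Complex.cos (2 * s * a) * Complex.cos (2 * s * c) / Complex.cosh (Real.pi * s)))
    measurableSet_Ioi ?_]
  · rw [integral_const_mul, key, hden, hca, hch]
    have hpi : (Real.pi : ℂ) ≠ 0 := by exact_mod_cast Real.pi_ne_zero
    have hq : ((Real.sqrt (1 + r) : ℝ) : ℂ) ≠ 0 := by
      have : 0 < Real.sqrt (1 + r) := Real.sqrt_pos.mpr (by linarith)
      exact_mod_cast this.ne'
    rw [Complex.ofReal_inv]
    field_simp
    norm_num
  · intro s hs
    simp only
    rw [aux_gamma s hs, hphi]
    push_cast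
    ring
end

section
/- Let A > −1, r > 0 and B ≥ 0 be real numbers. Then (1/(2π))·∫_0^∞ [Γ(is)·Γ(−is)·(Γ(1/2+is)·Γ(1/2−is))²/(Γ(2is)·Γ(−2is))]·(1+r)^{−1/2}·cos(2s·log(√(r+1)+√r))·φ_A(s)·φ_B(s) ds = π·(1+A)^{1/2}·(1+B)^{1/2}·(1+A+r+B)/((1+A+r+B)² + 4rAB). -/
open MeasureTheory

lemma phiF_exists (A : ℝ) (hA : -1 < A) : ∃ z : ℂ, |z.im| < Real.pi / 2 ∧ (0 ≤ A → z.im = 0) ∧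
    Complex.cosh z = (Real.sqrt (1 + A) : ℝ) ∧
    ∀ s : ℝ, (phiF A s : ℂ) = Complex.cos (2 * z * s) := by
  by_cases h : 0 ≤ A
  · have e : Real.log (Real.sqrt (A + 1) + Real.sqrt A) = Real.arsinh (Real.sqrt A) := by
      rw [Real.arsinh, Real.sq_sqrt h, add_comm, add_comm A]
    refine ⟨(Real.arsinh (Real.sqrt A) : ℝ), ?_, fun _ => Complex.ofReal_im _, ?_, fun s => ?_⟩
    · simp [Real.pi_pos]
    · rw [← Complex.ofReal_cosh, Real.cosh_arsinh, Real.sq_sqrt h]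
    · rw [phiF, if_pos h, e]
      push_cast
      congr 1; ring
  · have h' : 0 < -A := by linarith
    have h1 : Real.sqrt (-A) < 1 := by
      rw [Real.sqrt_lt' one_pos]; linarith
    refine ⟨(Real.arcsin (Real.sqrt (-A)) : ℝ) * Complex.I, ?_, fun h2 => absurd h2 h, ?_,
      fun s => ?_⟩
    · have h2 := Real.arcsin_lt_pi_div_two.2 h1
      have h3 := Real.arcsin_nonneg.2 (Real.sqrt_nonneg (-A))
      simpa [abs_of_nonneg h3] using h2
    · rw [Complex.cosh_mul_I, ← Complex.ofReal_cos, Real.cos_arcsin, Real.sq_sqrt h'.le,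
        sub_neg_eq_add]
    · rw [phiF, if_neg h]
      push_cast
      rw [← Complex.cos_mul_I]
      congr 1; ring

lemma cosh_ne (w : ℂ) (hw : |w.im| < Real.pi / 2) : Complex.cosh w ≠ 0 := by
  intro h
  have h1 : (Complex.cosh w).re = Real.cosh w.re * Real.cos w.im := by
    conv_lhs => rw [← Complex.re_add_im w]
    rw [Complex.cosh_add, Complex.cosh_mul_I, Complex.sinh_mul_I]
    rw [← Complex.ofReal_cosh, ← Complex.ofReal_sinh, ← Complex.ofReal_cos, ← Complex.ofReal_sin]
    simp only [Complex.add_re, Complex.mul_re, Complex.mul_im, Complex.ofReal_re, Complex.ofReal_im,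
      Complex.I_re, Complex.I_im]
    ring
  rw [h] at h1
  have := mul_pos (Real.cosh_pos w.re) (Real.cos_pos_of_mem_Ioo (abs_lt.1 hw |>.imp_left (by
    intro h; linarith)))
  simp at h1
  rcases h1 with h1 | h1
  · exact absurd h1 (Real.cosh_pos _).ne'
  · rw [h1] at this; simp at this

lemma weight (s : ℝ) (hs : 0 < s) :
   (Complex.Gamma (Complex.I * s) * Complex.Gamma (-(Complex.I * s)) *
          (Complex.Gamma (1 / 2 + Complex.I * s) * Complex.Gamma (1 / 2 - Complex.I * s)) ^ 2 /
          (Complex.Gamma (2 * Complex.I * s) * Complex.Gamma (-(2 * Complex.I * s)))) =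
   4 * (Real.pi : ℂ) ^ 2 / Complex.cosh (Real.pi * s) := by
  have refl : ∀ z : ℂ, z ≠ 0 → Complex.Gamma z * Complex.Gamma (-z) =
      - Real.pi / (z * Complex.sin (Real.pi * z)) := by
    intro z hz
    have h1 := Complex.Gamma_mul_Gamma_one_sub z
    have h2 := Complex.Gamma_add_one (-z) (neg_ne_zero.2 hz)
    rw [show 1 - z = -z + 1 by ring, h2] at h1
    rw [neg_div, div_mul_eq_div_div_swap, ← h1]
    field_simp
  have hsc : (s : ℂ) ≠ 0 := by exact_mod_cast hs.ne'
  have hI := Complex.I_ne_zero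
  have hpi : (Real.pi : ℂ) ≠ 0 := by exact_mod_cast Real.pi_ne_zero
  have hc : Complex.cosh (Real.pi * s) ≠ 0 := by
    rw [← Complex.ofReal_mul, ← Complex.ofReal_cosh]
    exact_mod_cast (Real.cosh_pos _).ne'
  have hsh : Complex.sinh (Real.pi * s) ≠ 0 := by
    rw [← Complex.ofReal_mul, ← Complex.ofReal_sinh]
    exact_mod_cast (Real.sinh_pos_iff.2 (mul_pos Real.pi_pos hs)).ne'
  have e1 := Complex.Gamma_mul_Gamma_one_sub (1 / 2 + Complex.I * s)
  rw [show 1 - (1 / 2 + Complex.I * s) = 1 / 2 - Complex.I * s by ring,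
    show (Real.pi : ℂ) * (1 / 2 + Complex.I * s) = (Real.pi * s) * Complex.I + Real.pi / 2 by ring,
    Complex.sin_add_pi_div_two, Complex.cos_mul_I] at e1
  rw [refl _ (mul_ne_zero hI hsc), refl _ (mul_ne_zero (mul_ne_zero two_ne_zero hI) hsc), e1,
    show (Real.pi : ℂ) * (Complex.I * s) = (Real.pi * s) * Complex.I by ring,
    show (Real.pi : ℂ) * (2 * Complex.I * s) = (2 * (Real.pi * s)) * Complex.I by ring,
    Complex.sin_mul_I, Complex.sin_mul_I, Complex.sinh_two_mul]
  field_simp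
  try ring

lemma fourier_sech (w : ℂ) (hw : |w.im| < Real.pi / 2) :
    Integrable (fun s : ℝ => Complex.exp (2 * Complex.I * w * s) / Complex.cosh (Real.pi * s)) ∧
    ∫ s : ℝ, Complex.exp (2 * Complex.I * w * s) / Complex.cosh (Real.pi * s)
      = 1 / Complex.cosh w := by
  have hpi : (Real.pi : ℂ) ≠ 0 := by exact_mod_cast Real.pi_ne_zero
  set u : ℂ := 1 / 2 + Complex.I * w / Real.pi with hu
  have hure : u.re = 1 / 2 - w.im / Real.pi := by
    rw [hu, Complex.add_re, Complex.div_ofReal_re]; simp; ring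
  have hb : |w.im / Real.pi| < 1 / 2 := by
    rw [abs_div, abs_of_pos Real.pi_pos, div_lt_iff₀ Real.pi_pos]; linarith
  have hb' := abs_lt.1 hb
  have hu0 : 0 < u.re := by rw [hure]; linarith
  have hu1 : 0 < (1 - u).re := by rw [Complex.sub_re, hure]; simp; linarith
  have hconv := Complex.betaIntegral_convergent hu0 hu1
  have hval := Complex.Gamma_mul_Gamma_eq_betaIntegral hu0 hu1
  rw [Complex.Gamma_mul_Gamma_one_sub, add_sub_cancel, Complex.Gamma_one, one_mul,
    show (Real.pi : ℂ) * u = w * Complex.I + Real.pi / 2 by rw [hu]; field_simp; ring,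
    Complex.sin_add_pi_div_two, Complex.cos_mul_I, Complex.betaIntegral,
    intervalIntegral.integral_of_le zero_le_one, integral_Ioc_eq_integral_Ioo] at hval
  rw [intervalIntegrable_iff_integrableOn_Ioo_of_le zero_le_one] at hconv
  set g : ℝ → ℂ := fun x => (x : ℂ) ^ (u - 1) * (1 - (x : ℂ)) ^ (1 - u - 1) with hg
  set f : ℝ → ℝ := fun s => Real.sigmoid (2 * Real.pi * s) with hf
  set f' : ℝ → ℝ := fun s => f s * (1 - f s) * (2 * Real.pi) with hf'
  have hder : ∀ s ∈ (Set.univ : Set ℝ), HasDerivWithinAt f (f' s) Set.univ s := by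
    intro s _
    have := (Real.hasDerivAt_sigmoid (2 * Real.pi * s)).comp s
      ((hasDerivAt_id s).const_mul (2 * Real.pi))
    rw [hasDerivWithinAt_univ]
    simpa [hf', hf, Function.comp_def] using this
  have hinj : Set.InjOn f Set.univ := by
    intro x _ y _ h
    have := Real.sigmoid_strictMono.injective h
    have h2 : (2 * Real.pi) ≠ 0 := by positivity
    exact mul_left_cancel₀ h2 this
  have himg : f '' Set.univ = Set.Ioo 0 1 := by
    rw [Set.image_univ, ← Real.range_sigmoid]
    ext y; constructor
    · rintro ⟨x, rfl⟩; exact ⟨_, rfl⟩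
    · rintro ⟨x, rfl⟩
      refine ⟨x / (2 * Real.pi), ?_⟩
      simp only [hf]
      congr 1
      field_simp
  have key : ∀ s : ℝ, |f' s| • g (f s) =
      Real.pi * (Complex.exp (2 * Complex.I * w * s) / Complex.cosh (Real.pi * s)) := by
    intro s
    have f0 : 0 < f s := Real.sigmoid_pos _
    have f1 : f s < 1 := Real.sigmoid_lt_one _
    have f1' : 0 < 1 - f s := by linarith
    have c0 : (f s : ℂ) ≠ 0 := by exact_mod_cast f0.ne'
    have c1 : (1 - f s : ℂ) ≠ 0 := by exact_mod_cast f1'.ne'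
    have E0 := Real.exp_pos (Real.pi * s)
    have hrat : f s = Real.exp (2 * Real.pi * s) * (1 - f s) := by
      simp only [hf, Real.sigmoid_def, Real.exp_neg]
      have := Real.exp_pos (2 * Real.pi * s)
      field_simp
      try ring
    have hcosh : f s * (1 - f s) * (4 * Real.cosh (Real.pi * s) ^ 2) = 1 := by
      rw [Real.cosh_eq]
      simp only [hf, Real.sigmoid_def, Real.exp_neg]
      rw [show 2 * Real.pi * s = Real.pi * s + Real.pi * s by ring, Real.exp_add]
      field_simp
      ring
    have hone : (1 - f s) * (2 * Real.cosh (Real.pi * s)) * Real.exp (Real.pi * s) = 1 := by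
      rw [Real.cosh_eq]
      simp only [hf, Real.sigmoid_def, Real.exp_neg]
      rw [show 2 * Real.pi * s = Real.pi * s + Real.pi * s by ring, Real.exp_add]
      field_simp
      try ring
    have hC : Complex.cosh (Real.pi * s) ≠ 0 := by
      rw [← Complex.ofReal_mul, ← Complex.ofReal_cosh]
      exact_mod_cast (Real.cosh_pos _).ne'
    have hpw : (f s : ℂ) ^ u = Complex.exp (2 * Real.pi * s * u) * (1 - (f s : ℂ)) ^ u := by
      have hl : Real.log (f s) = 2 * Real.pi * s + Real.log (1 - f s) := by
        conv_lhs => rw [hrat]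
        rw [Real.log_mul (Real.exp_pos _).ne' f1'.ne', Real.log_exp]
      rw [Complex.cpow_def_of_ne_zero c0, Complex.cpow_def_of_ne_zero c1, ← Complex.exp_add,
        ← Complex.ofReal_log f0.le, show (1 - (f s : ℂ)) = ((1 - f s : ℝ) : ℂ) by push_cast; rfl,
        ← Complex.ofReal_log f1'.le, hl]
      congr 1; push_cast; ring
    have hgs : g (f s) = Complex.exp (2 * Real.pi * s * u) / (f s) := by
      simp only [hg]
      rw [Complex.cpow_sub _ _ c0, Complex.cpow_one, hpw,
        show 1 - u - 1 = -u by ring, Complex.cpow_neg]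
      have : (1 - (f s : ℂ)) ^ u ≠ 0 := by simp [Complex.cpow_eq_zero_iff, c1]
      field_simp
    have hex : Complex.exp (2 * Real.pi * s * u) =
        Complex.exp (Real.pi * s) * Complex.exp (2 * Complex.I * w * s) := by
      rw [← Complex.exp_add, hu]; congr 1; field_simp
    have hpos : 0 ≤ f' s := by simp only [hf']; have := Real.pi_pos; positivity
    rw [abs_of_nonneg hpos, hgs, hex, Complex.real_smul]
    have hone' : (1 - (f s : ℂ)) * (2 * Complex.cosh (Real.pi * s)) * Complex.exp (Real.pi * s)
        = 1 := by exact_mod_cast congrArg (fun x : ℝ => (x : ℂ)) hone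
    simp only [hf']
    push_cast
    rw [eq_comm, mul_div_assoc', div_eq_iff hC]
    field_simp
    linear_combination (-1) * hone'
  have hint := (integrableOn_image_iff_integrableOn_abs_deriv_smul MeasurableSet.univ hder hinj g).1
    (by rw [himg]; exact hconv)
  have hI := integral_image_eq_integral_abs_deriv_smul MeasurableSet.univ hder hinj g
  rw [himg, ← hval] at hI
  simp only [key, integrableOn_univ, Measure.restrict_univ] at hint hI
  constructor
  · have := hint.const_mul (Real.pi : ℂ)⁻¹
    simpa [← mul_assoc, hpi] using this
  · rw [integral_const_mul] at hI
    apply mul_left_cancel₀ hpi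
    rw [← hI]; ring

lemma cosint (w : ℂ) (hw : |w.im| < Real.pi / 2) :
    IntegrableOn (fun s : ℝ => Complex.cos (2 * w * s) / Complex.cosh (Real.pi * s)) (Set.Ioi 0) ∧
    ∫ s in Set.Ioi (0 : ℝ), Complex.cos (2 * w * s) / Complex.cosh (Real.pi * s)
      = 1 / (2 * Complex.cosh w) := by
  obtain ⟨i1, e1⟩ := fourier_sech w hw
  obtain ⟨i2, e2⟩ := fourier_sech (-w) (by simpa using hw)
  have hfe : (fun s : ℝ => Complex.cos (2 * w * s) / Complex.cosh (Real.pi * s)) = fun s : ℝ =>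
      (1 / 2 : ℂ) * (Complex.exp (2 * Complex.I * w * s) / Complex.cosh (Real.pi * s) +
      Complex.exp (2 * Complex.I * (-w) * s) / Complex.cosh (Real.pi * s)) := by
    funext s
    rw [Complex.cos, show 2 * w * s * Complex.I = 2 * Complex.I * w * s by ring,
      show -(2 * w * s) * Complex.I = 2 * Complex.I * (-w) * s by ring]
    ring
  have hi : Integrable (fun s : ℝ => Complex.cos (2 * w * s) / Complex.cosh (Real.pi * s)) := by
    rw [hfe]; exact (i1.add i2).const_mul _
  have htot : ∫ s : ℝ, Complex.cos (2 * w * s) / Complex.cosh (Real.pi * s)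
      = 1 / Complex.cosh w := by
    rw [hfe, integral_const_mul, integral_add i1 i2, e1, e2, Complex.cosh_neg]; ring
  refine ⟨hi.integrableOn, ?_⟩
  have hs := intervalIntegral.integral_Iic_add_Ioi (b := (0:ℝ)) hi.integrableOn hi.integrableOn
  have hn := integral_comp_neg_Ioi (0:ℝ)
    (fun s : ℝ => Complex.cos (2 * w * s) / Complex.cosh (Real.pi * s))
  simp only [Complex.ofReal_neg, mul_neg, Complex.cos_neg, Complex.cosh_neg, neg_zero] at hn
  rw [← hn, htot] at hs
  have h2 : 1 / (2 * Complex.cosh w) = (1 / 2) * (1 / Complex.cosh w) := by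
    rw [one_div_mul_one_div]
  rw [h2, ← hs]; ring

theorem stmt_8 (A r B : ℝ) (hA : -1 < A) (hr : 0 < r) (hB : 0 ≤ B) :
    (1 / (2 * Real.pi) : ℂ) *
      ∫ s in Set.Ioi (0 : ℝ),
        (Complex.Gamma (Complex.I * s) * Complex.Gamma (-(Complex.I * s)) *
          (Complex.Gamma (1 / 2 + Complex.I * s) * Complex.Gamma (1 / 2 - Complex.I * s)) ^ 2 /
          (Complex.Gamma (2 * Complex.I * s) * Complex.Gamma (-(2 * Complex.I * s)))) *
        (((1 + r) ^ (-(1 / 2 : ℝ)) : ℝ) : ℂ) *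
        (Real.cos (2 * s * Real.log (Real.sqrt (r + 1) + Real.sqrt r)) : ℝ) *
        (phiF A s : ℝ) * (phiF B s : ℝ) =
    (Real.pi : ℂ) * (((1 + A) ^ ((1 / 2 : ℝ)) : ℝ) : ℂ) * (((1 + B) ^ ((1 / 2 : ℝ)) : ℝ) : ℂ) *
      ((1 + A + r + B : ℝ) : ℂ) / (((1 + A + r + B) ^ 2 + 4 * r * A * B : ℝ) : ℂ) := by
  obtain ⟨a, ha1, ha2, ha3, ha4⟩ := phiF_exists r (by linarith)
  obtain ⟨b, hb1, hb2, hb3, hb4⟩ := phiF_exists B (by linarith)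
  obtain ⟨c, hc1, -, hc3, hc4⟩ := phiF_exists A hA
  replace ha2 := ha2 hr.le
  replace hb2 := hb2 hB
  have hpi : (Real.pi : ℂ) ≠ 0 := by exact_mod_cast Real.pi_ne_zero
  have b1 : |(a + b + c).im| < Real.pi / 2 := by simpa [ha2, hb2] using hc1
  have b2 : |(a + b - c).im| < Real.pi / 2 := by simpa [ha2, hb2] using hc1
  have b3 : |(a - b + c).im| < Real.pi / 2 := by simpa [ha2, hb2] using hc1
  have b4 : |(a - b - c).im| < Real.pi / 2 := by simpa [ha2, hb2] using hc1
  obtain ⟨i1, e1⟩ := cosint _ b1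
  obtain ⟨i2, e2⟩ := cosint _ b2
  obtain ⟨i3, e3⟩ := cosint _ b3
  obtain ⟨i4, e4⟩ := cosint _ b4
  have n1 := cosh_ne _ b1
  have n2 := cosh_ne _ b2
  have n3 := cosh_ne _ b3
  have n4 := cosh_ne _ b4
  have na := cosh_ne _ ha1
  have hr1 : (((1 + r) ^ (-(1 / 2 : ℝ)) : ℝ) : ℂ) = (Complex.cosh a)⁻¹ := by
    rw [Real.rpow_neg (by linarith), ← Real.sqrt_eq_rpow, ha3, Complex.ofReal_inv]
  rw [← Real.sqrt_eq_rpow, ← Real.sqrt_eq_rpow, ← hc3, ← hb3, hr1]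
  have hint : ∫ s in Set.Ioi (0 : ℝ),
        (Complex.Gamma (Complex.I * s) * Complex.Gamma (-(Complex.I * s)) *
          (Complex.Gamma (1 / 2 + Complex.I * s) * Complex.Gamma (1 / 2 - Complex.I * s)) ^ 2 /
          (Complex.Gamma (2 * Complex.I * s) * Complex.Gamma (-(2 * Complex.I * s)))) *
        (Complex.cosh a)⁻¹ *
        (Real.cos (2 * s * Real.log (Real.sqrt (r + 1) + Real.sqrt r)) : ℝ) *
        (phiF A s : ℝ) * (phiF B s : ℝ) = ∫ s in Set.Ioi (0 : ℝ),
        ((Real.pi : ℂ) ^ 2 * (Complex.cosh a)⁻¹) *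
        (((Complex.cos (2 * (a + b + c) * s) / Complex.cosh (Real.pi * s) +
        Complex.cos (2 * (a + b - c) * s) / Complex.cosh (Real.pi * s)) +
        Complex.cos (2 * (a - b + c) * s) / Complex.cosh (Real.pi * s)) +
        Complex.cos (2 * (a - b - c) * s) / Complex.cosh (Real.pi * s)) := by
    refine setIntegral_congr_fun measurableSet_Ioi fun s hs => ?_
    have har : (Real.cos (2 * s * Real.log (Real.sqrt (r + 1) + Real.sqrt r)) : ℂ) =
        Complex.cos (2 * a * s) := by
      rw [← ha4 s, phiF, if_pos hr.le]
    beta_reduce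
    rw [weight s hs, har, hc4, hb4,
      show 2 * (a + b + c) * (s : ℂ) = 2 * a * s + 2 * b * s + 2 * c * s by ring,
      show 2 * (a + b - c) * (s : ℂ) = 2 * a * s + 2 * b * s - 2 * c * s by ring,
      show 2 * (a - b + c) * (s : ℂ) = 2 * a * s - 2 * b * s + 2 * c * s by ring,
      show 2 * (a - b - c) * (s : ℂ) = 2 * a * s - 2 * b * s - 2 * c * s by ring]
    simp only [Complex.cos_add, Complex.cos_sub, Complex.sin_add, Complex.sin_sub]
    ring
  rw [hint, integral_const_mul, integral_add ((i1.fun_add i2).fun_add i3) i4, integral_add (i1.fun_add i2) i3,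
    integral_add i1 i2, e1, e2, e3, e4]
  have sq : ∀ x : ℝ, -1 < x → ((Real.sqrt (1 + x) : ℝ) : ℂ) ^ 2 = 1 + x := by
    intro x hx
    rw [← Complex.ofReal_pow, Real.sq_sqrt (by linarith)]; push_cast; rfl
  have hrr : (r : ℂ) = Complex.sinh a ^ 2 := by
    rw [Complex.sinh_sq, ha3, sq r (by linarith)]; ring
  have hBB : (B : ℂ) = Complex.sinh b ^ 2 := by
    rw [Complex.sinh_sq, hb3, sq B (by linarith)]; ring
  have hAA : (A : ℂ) = Complex.sinh c ^ 2 := by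
    rw [Complex.sinh_sq, hc3, sq A (by linarith)]; ring
  push_cast
  have sa := Complex.cosh_sq a
  have sb := Complex.cosh_sq b
  have sc := Complex.cosh_sq c
  set P := Complex.cosh (a + b) with hP
  set Q := Complex.cosh (a - b) with hQ
  have p1 : Complex.cosh (a + b + c) * Complex.cosh (a + b - c) = P ^ 2 + A := by
    rw [Complex.cosh_add (a + b), Complex.cosh_sub (a + b), hAA]
    linear_combination (P ^ 2) * sc - Complex.sinh c ^ 2 * Complex.sinh_sq (a + b)
  have p2 : Complex.cosh (a - b + c) * Complex.cosh (a - b - c) = Q ^ 2 + A := by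
    rw [Complex.cosh_add (a - b), Complex.cosh_sub (a - b), hAA]
    linear_combination (Q ^ 2) * sc - Complex.sinh c ^ 2 * Complex.sinh_sq (a - b)
  have q1 : Complex.cosh (a + b + c) + Complex.cosh (a + b - c) = 2 * P * Complex.cosh c := by
    rw [Complex.cosh_add (a + b), Complex.cosh_sub (a + b)]; ring
  have q2 : Complex.cosh (a - b + c) + Complex.cosh (a - b - c) = 2 * Q * Complex.cosh c := by
    rw [Complex.cosh_add (a - b), Complex.cosh_sub (a - b)]; ring
  have m1 : P ^ 2 + A ≠ 0 := by rw [← p1]; exact mul_ne_zero n1 n2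
  have m2 : Q ^ 2 + A ≠ 0 := by rw [← p2]; exact mul_ne_zero n3 n4
  have hPe : P = Complex.cosh a * Complex.cosh b + Complex.sinh a * Complex.sinh b :=
    Complex.cosh_add a b
  have hQe : Q = Complex.cosh a * Complex.cosh b - Complex.sinh a * Complex.sinh b :=
    Complex.cosh_sub a b
  have hPQ : P * Q = 1 + r + B := by
    rw [hPe, hQe, hrr, hBB]
    linear_combination Complex.cosh b ^ 2 * sa + (Complex.sinh a ^ 2 + 1) * sb
  have hden : (1 + (A : ℂ) + r + B) ^ 2 + 4 * r * A * B = (P ^ 2 + A) * (Q ^ 2 + A) := by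
    have : 1 + (A : ℂ) + r + B = P * Q + A := by rw [hPQ]; ring
    rw [this, hrr, hBB, hPe, hQe]; ring
  have hnum : 1 + (A : ℂ) + r + B = P * Q + A := by rw [hPQ]; ring
  have s1 : 1 / (2 * Complex.cosh (a + b + c)) + 1 / (2 * Complex.cosh (a + b - c)) =
      P * Complex.cosh c / (P ^ 2 + A) := by
    rw [← p1]; field_simp; linear_combination q1
  have s2 : 1 / (2 * Complex.cosh (a - b + c)) + 1 / (2 * Complex.cosh (a - b - c)) =
      Q * Complex.cosh c / (Q ^ 2 + A) := by
    rw [← p2]; field_simp; linear_combination q2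
  have hsum : P + Q = 2 * Complex.cosh a * Complex.cosh b := by rw [hPe, hQe]; ring
  rw [hden, hnum, s1, add_assoc, s2]
  field_simp
  linear_combination (Complex.cosh c * (P * Q + A)) * hsum
end

section
/- Let 0 < T < S < 1. For every r > 0, (1/π)·∫_0^∞ w_r(t)·(π/(√(1−T)·√(1−S))) dt = (1+r)^{−1}·π²/(√(1−T)·√(1−S)), where the integral is over real t. -/
open MeasureTheory

/-- The weight `w_r(t) = Γ(2it)Γ(−2it)(Γ(1/2+2it)Γ(1/2−2it))²/(Γ(4it)Γ(−4it)) ·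
(1+r)^{−1/2}·cos(4t·log(√(r+1)+√r))`. -/
noncomputable def wfun (r t : ℝ) : ℂ :=
  Complex.Gamma (2 * Complex.I * t) * Complex.Gamma (-(2 * Complex.I * t)) *
    (Complex.Gamma (1 / 2 + 2 * Complex.I * t) * Complex.Gamma (1 / 2 - 2 * Complex.I * t)) ^ 2 /
    (Complex.Gamma (4 * Complex.I * t) * Complex.Gamma (-(4 * Complex.I * t))) *
    (((1 + r) ^ (-(1 / 2 : ℝ)) : ℝ) : ℂ) *
    (Real.cos (4 * t * Real.log (Real.sqrt (r + 1) + Real.sqrt r)) : ℝ)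

theorem aux_ratio (t : ℝ) (ht : 0 < t) :
    Complex.Gamma (2 * Complex.I * t) * Complex.Gamma (-(2 * Complex.I * t)) *
    (Complex.Gamma (1 / 2 + 2 * Complex.I * t) * Complex.Gamma (1 / 2 - 2 * Complex.I * t)) ^ 2 /
    (Complex.Gamma (4 * Complex.I * t) * Complex.Gamma (-(4 * Complex.I * t)))
    = ((4 * Real.pi ^ 2 / Real.cosh (2 * Real.pi * t) : ℝ) : ℂ) := by
  have h1 := Complex.Gamma_mul_Gamma_add_half (2 * Complex.I * t)
  have h2 := Complex.Gamma_mul_Gamma_add_half (-(2 * Complex.I * t))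
  have h3 := Complex.Gamma_mul_Gamma_one_sub (1 / 2 + 2 * Complex.I * t)
  rw [show 2 * (2 * Complex.I * (t : ℂ)) = 4 * Complex.I * t by ring,
    add_comm (2 * Complex.I * (t : ℂ))] at h1
  rw [show 2 * -(2 * Complex.I * (t : ℂ)) = -(4 * Complex.I * t) by ring,
    show -(2 * Complex.I * (t : ℂ)) + 1 / 2 = 1 / 2 - 2 * Complex.I * t by ring] at h2
  rw [show 1 - (1 / 2 + 2 * Complex.I * (t : ℂ)) = 1 / 2 - 2 * Complex.I * t by ring,
    show (Real.pi : ℂ) * (1 / 2 + 2 * Complex.I * (t : ℂ))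
      = ((2 * Real.pi * t : ℝ) : ℂ) * Complex.I + Real.pi / 2 by push_cast; ring,
    Complex.sin_add_pi_div_two, Complex.cos_mul_I] at h3
  have hI : ∀ m : ℕ, (4 * Complex.I * (t : ℂ)) ≠ -m := by
    intro m h
    have := congrArg Complex.im h
    simp at this
    exact ht.ne' this
  have hI' : ∀ m : ℕ, -(4 * Complex.I * (t : ℂ)) ≠ -m := by
    intro m h
    have := congrArg Complex.im h
    simp at this
    exact ht.ne' this
  have n1 := Complex.Gamma_ne_zero hI
  have n2 := Complex.Gamma_ne_zero hI'
  have hp : (2 : ℂ) ^ (1 - 4 * Complex.I * (t : ℂ)) * (2 : ℂ) ^ (1 - -(4 * Complex.I * (t : ℂ))) = 4 := by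
    rw [← Complex.cpow_add _ _ two_ne_zero,
      show (1 - 4 * Complex.I * (t : ℂ)) + (1 - -(4 * Complex.I * (t : ℂ))) = (2 : ℕ) by
        push_cast; ring, Complex.cpow_natCast]
    norm_num
  have hs : ((√Real.pi : ℝ) : ℂ) * ((√Real.pi : ℝ) : ℂ) = Real.pi := by
    rw [← Complex.ofReal_mul, Real.mul_self_sqrt Real.pi_pos.le]
  rw [div_eq_iff (mul_ne_zero n1 n2)]
  push_cast
  push_cast at h3
  calc _ = (Complex.Gamma (2 * Complex.I * t) * Complex.Gamma (1 / 2 + 2 * Complex.I * t)) *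
        (Complex.Gamma (-(2 * Complex.I * t)) * Complex.Gamma (1 / 2 - 2 * Complex.I * t)) *
        (Complex.Gamma (1 / 2 + 2 * Complex.I * t) * Complex.Gamma (1 / 2 - 2 * Complex.I * t)) := by
          ring
    _ = (Complex.Gamma (4 * Complex.I * t) * Complex.Gamma (-(4 * Complex.I * t))) *
        ((2 : ℂ) ^ (1 - 4 * Complex.I * (t : ℂ)) * (2 : ℂ) ^ (1 - -(4 * Complex.I * (t : ℂ)))) *
        (((√Real.pi : ℝ) : ℂ) * ((√Real.pi : ℝ) : ℂ)) *
        (Real.pi / Complex.cosh (2 * Real.pi * t)) := by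
          rw [h1, h2, h3]; ring
    _ = _ := by rw [hp, hs]; ring

theorem aux_point (a s : ℝ) :
    |Real.sigmoid s * (1 - Real.sigmoid s)| •
      ((Real.sigmoid s : ℂ) ^ ((1 / 2 + a * Complex.I) - 1 : ℂ) *
        (1 - (Real.sigmoid s : ℂ)) ^ ((1 / 2 - a * Complex.I) - 1 : ℂ))
    = Complex.exp (a * s * Complex.I) / (2 * Real.cosh (s / 2) : ℝ) := by
  have hx := Real.sigmoid_pos s
  have hy : 0 < 1 - Real.sigmoid s := sub_pos.2 (Real.sigmoid_lt_one s)
  have hy' : 1 - Real.sigmoid s = Real.sigmoid s * Real.exp (-s) := by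
    rw [Real.sigmoid_mul_rexp_neg, Real.sigmoid_neg]
  have hxc : (Real.sigmoid s : ℂ) ≠ 0 := by exact_mod_cast hx.ne'
  have hyc : ((1 - Real.sigmoid s : ℝ) : ℂ) ≠ 0 := by exact_mod_cast hy.ne'
  have hl : Real.log (1 - Real.sigmoid s) = Real.log (Real.sigmoid s) - s := by
    rw [hy', Real.log_mul hx.ne' (Real.exp_pos _).ne', Real.log_exp]; ring
  rw [abs_of_pos (mul_pos hx hy), Complex.real_smul, Complex.ofReal_mul]
  have e1 : (1 - (Real.sigmoid s : ℂ)) = ((1 - Real.sigmoid s : ℝ) : ℂ) := by push_cast; ring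
  rw [e1, Complex.cpow_sub _ _ hxc, Complex.cpow_sub _ _ hyc, Complex.cpow_one, Complex.cpow_one]
  have e2 : ∀ A B C D : ℂ, C ≠ 0 → D ≠ 0 → C * D * (A / C * (B / D)) = A * B := by
    intro A B C D hC hD; field_simp
  rw [e2 _ _ _ _ hxc hyc, Complex.cpow_def_of_ne_zero hxc, Complex.cpow_def_of_ne_zero hyc,
    ← Complex.ofReal_log hx.le, ← Complex.ofReal_log hy.le, hl, ← Complex.exp_add]
  have e3 : (Real.log (Real.sigmoid s) : ℂ) * (1 / 2 + a * Complex.I)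
      + ((Real.log (Real.sigmoid s) - s : ℝ) : ℂ) * (1 / 2 - a * Complex.I)
      = (a * s * Complex.I) + ((Real.log (Real.sigmoid s) + -(s / 2) : ℝ) : ℂ) := by
    push_cast; ring
  rw [e3, Complex.exp_add, ← Complex.ofReal_exp, Real.exp_add, Real.exp_log hx,
    div_eq_mul_inv (Complex.exp _), ← Complex.ofReal_inv]
  congr 2
  rw [Real.cosh_eq, Real.sigmoid_def]
  have e4 : Real.exp (-s) = Real.exp (-(s/2)) * Real.exp (-(s/2)) := by
    rw [← Real.exp_add]; ring_nf
  have e5 : Real.exp (s/2) * Real.exp (-(s/2)) = 1 := by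
    rw [← Real.exp_add]; simp
  have p1 := Real.exp_pos (s/2)
  have p2 := Real.exp_pos (-(s/2))
  rw [e4]
  field_simp
  linear_combination e5

theorem aux_img : Real.sigmoid '' Set.univ = Set.Ioo 0 1 := by
  rw [Set.image_univ, Real.range_sigmoid]

theorem aux_integrable (a : ℝ) :
    Integrable (fun s : ℝ => Complex.exp (a * s * Complex.I) / (2 * Real.cosh (s / 2) : ℝ)) := by
  have h := Complex.betaIntegral_convergent (u := 1 / 2 + a * Complex.I)
    (v := 1 / 2 - a * Complex.I) (by simp) (by simp)
  rw [intervalIntegrable_iff_integrableOn_Ioo_of_le zero_le_one, ← aux_img,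
    integrableOn_image_iff_integrableOn_abs_deriv_smul MeasurableSet.univ
      (fun x _ => (Real.hasDerivAt_sigmoid x).hasDerivWithinAt)
      Real.sigmoid_injective.injOn, integrableOn_univ] at h
  simpa only [aux_point] using h

theorem aux_integral (a : ℝ) :
    ∫ s : ℝ, Complex.exp (a * s * Complex.I) / (2 * Real.cosh (s / 2) : ℝ)
      = ((Real.pi / Real.cosh (Real.pi * a) : ℝ) : ℂ) := by
  have h := Complex.Gamma_mul_Gamma_eq_betaIntegral (s := 1 / 2 + a * Complex.I)
    (t := 1 / 2 - a * Complex.I) (by simp) (by simp)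
  have h3 := Complex.Gamma_mul_Gamma_one_sub (1 / 2 + a * Complex.I)
  rw [show 1 - (1 / 2 + (a : ℂ) * Complex.I) = 1 / 2 - a * Complex.I by ring,
    show (Real.pi : ℂ) * (1 / 2 + a * Complex.I)
      = ((Real.pi * a : ℝ) : ℂ) * Complex.I + Real.pi / 2 by push_cast; ring,
    Complex.sin_add_pi_div_two, Complex.cos_mul_I] at h3
  rw [h3, show (1 / 2 + (a : ℂ) * Complex.I) + (1 / 2 - a * Complex.I) = 1 by ring,
    Complex.Gamma_one, one_mul, Complex.betaIntegral,
    intervalIntegral.integral_of_le zero_le_one, integral_Ioc_eq_integral_Ioo, ← aux_img,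
    integral_image_eq_integral_abs_deriv_smul MeasurableSet.univ
      (fun x _ => (Real.hasDerivAt_sigmoid x).hasDerivWithinAt)
      Real.sigmoid_injective.injOn, setIntegral_univ] at h
  simp only [aux_point] at h
  rw [← h]; push_cast; rfl

theorem aux_real (a : ℝ) :
    ∫ s : ℝ, Real.cos (a * s) / (2 * Real.cosh (s / 2)) = Real.pi / Real.cosh (Real.pi * a) := by
  have h := integral_re (aux_integrable a)
  rw [aux_integral a] at h
  simp only [RCLike.re_eq_complex_re, Complex.div_ofReal_re, Complex.ofReal_re] at h
  rw [← h]
  refine integral_congr_ae (Filter.Eventually.of_forall fun s => ?_)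
  simp only
  rw [← Complex.ofReal_mul, Complex.exp_ofReal_mul_I_re]

theorem aux_half (L : ℝ) :
    ∫ t in Set.Ioi (0 : ℝ), 4 * Real.pi ^ 2 / Real.cosh (2 * Real.pi * t) * Real.cos (4 * t * L)
      = Real.pi ^ 2 / Real.cosh L := by
  have hpi := Real.pi_pos
  have h := aux_real (L / Real.pi)
  have h2 := Measure.integral_comp_mul_left
    (fun s : ℝ => Real.cos (L / Real.pi * s) / (2 * Real.cosh (s / 2))) (4 * Real.pi)
  rw [h, mul_div_cancel₀ _ hpi.ne'] at h2
  have h4 := integral_comp_abs (f := fun t : ℝ =>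
    4 * Real.pi ^ 2 / Real.cosh (2 * Real.pi * t) * Real.cos (4 * t * L))
  have h5 : ∀ t : ℝ, 4 * Real.pi ^ 2 / Real.cosh (2 * Real.pi * |t|) * Real.cos (4 * |t| * L)
      = 8 * Real.pi ^ 2 * (Real.cos (L / Real.pi * (4 * Real.pi * t)) /
        (2 * Real.cosh (4 * Real.pi * t / 2))) := by
    intro t
    have c1 : Real.cosh (2 * Real.pi * |t|) = Real.cosh (4 * Real.pi * t / 2) := by
      rw [← Real.cosh_abs (4 * Real.pi * t / 2)]
      congr 1
      rw [show 4 * Real.pi * t / 2 = 2 * Real.pi * t by ring, abs_mul, abs_of_pos (show 0 < 2 * Real.pi by positivity)]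
    have c2 : Real.cos (4 * |t| * L) = Real.cos (L / Real.pi * (4 * Real.pi * t)) := by
      rw [show L / Real.pi * (4 * Real.pi * t) = 4 * t * L by field_simp]
      rcases abs_choice t with h | h <;> rw [h]
      rw [← Real.cos_neg]; congr 1; ring
    rw [c1, c2]
    have := Real.cosh_pos (4 * Real.pi * t / 2)
    field_simp; ring
  simp only [h5] at h4
  rw [integral_const_mul, h2, smul_eq_mul, abs_of_pos (by positivity)] at h4
  have := Real.cosh_pos L
  have e : 8 * Real.pi ^ 2 * ((4 * Real.pi)⁻¹ * (Real.pi / Real.cosh L))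
     = 2 * (Real.pi ^ 2 / Real.cosh L) := by field_simp; ring
  rw [e] at h4
  linarith

theorem stmt_12 (T S : ℝ) (hT : 0 < T) (hTS : T < S) (hS : S < 1) (r : ℝ) (hr : 0 < r) :
    (1 / (Real.pi : ℂ)) *
      ∫ t in Set.Ioi (0 : ℝ),
        wfun r t * ((Real.pi : ℂ) / ((Real.sqrt (1 - T) : ℝ) * (Real.sqrt (1 - S) : ℝ))) =
    ((1 + r : ℝ) : ℂ)⁻¹ * (Real.pi : ℂ) ^ 2 /
      ((Real.sqrt (1 - T) : ℝ) * (Real.sqrt (1 - S) : ℝ)) := by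
  have hL : Real.log (Real.sqrt (r + 1) + Real.sqrt r) = Real.arsinh (Real.sqrt r) := by
    rw [Real.arsinh, Real.sq_sqrt hr.le, add_comm r 1, add_comm (Real.sqrt r)]
  have hI : ∫ t in Set.Ioi (0 : ℝ),
        wfun r t * ((Real.pi : ℂ) / ((Real.sqrt (1 - T) : ℝ) * (Real.sqrt (1 - S) : ℝ)))
      = ((Real.pi ^ 2 / (1 + r) : ℝ) : ℂ) *
        ((Real.pi : ℂ) / ((Real.sqrt (1 - T) : ℝ) * (Real.sqrt (1 - S) : ℝ))) := by
    rw [integral_mul_const]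
    congr 1
    have h1 : ∫ t in Set.Ioi (0 : ℝ), wfun r t = ∫ t in Set.Ioi (0 : ℝ),
        ((((1 + r) ^ (-(1 / 2 : ℝ)) * (4 * Real.pi ^ 2 / Real.cosh (2 * Real.pi * t) *
          Real.cos (4 * t * Real.arsinh (Real.sqrt r)))) : ℝ) : ℂ) := by
      refine setIntegral_congr_fun measurableSet_Ioi fun t ht => ?_
      simp only [wfun]
      rw [aux_ratio t ht, hL, ← Complex.ofReal_mul, ← Complex.ofReal_mul]
      congr 1
      ring
    rw [h1, integral_complex_ofReal, integral_const_mul, aux_half, Real.cosh_arsinh,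
      Real.sq_sqrt hr.le, Real.rpow_neg (by linarith), ← Real.sqrt_eq_rpow]
    congr 1
    have h0 : (0 : ℝ) < 1 + r := by linarith
    have h2 := Real.mul_self_sqrt h0.le
    have h3 := Real.sqrt_pos.2 h0
    rw [inv_mul_eq_div, div_div, h2]
  rw [hI]
  have hpi : (Real.pi : ℂ) ≠ 0 := by exact_mod_cast Real.pi_ne_zero
  push_cast
  field_simp
end

section
/- Let 0 < T < S < 1 and r > 0. Then E(r) + F(r)·z + G(r)·z² > 0 for every z with T ≤ z ≤ S. -/
open MeasureTheory

/-- `R = 2r(1−√T)(1−√S)`. -/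
noncomputable def Rc (S T r : ℝ) : ℝ := 2 * r * (1 - Real.sqrt T) * (1 - Real.sqrt S)

/-- `E(r) = (√T+√S−2√S√T)² + 2R√S√T`. -/
noncomputable def Ec (S T r : ℝ) : ℝ :=
  (Real.sqrt T + Real.sqrt S - 2 * Real.sqrt S * Real.sqrt T) ^ 2 +
    2 * Rc S T r * Real.sqrt S * Real.sqrt T

/-- `F(r) = 2(√T+√S−2)(√T+√S−2√S√T) + 2R(1+√S√T−2√T−2√S) + R²`. -/
noncomputable def Fc (S T r : ℝ) : ℝ :=
  2 * (Real.sqrt T + Real.sqrt S - 2) *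
      (Real.sqrt T + Real.sqrt S - 2 * Real.sqrt S * Real.sqrt T) +
    2 * Rc S T r * (1 + Real.sqrt S * Real.sqrt T - 2 * Real.sqrt T - 2 * Real.sqrt S) +
    Rc S T r ^ 2

/-- `G(r) = (√T+√S−2)² + 2R`. -/
noncomputable def Gc (S T r : ℝ) : ℝ :=
  (Real.sqrt T + Real.sqrt S - 2) ^ 2 + 2 * Rc S T r

/-- `I₂(r,z) = (√T+√S−2√S√T + R√z + z(√T+√S−2))/(E(r)+F(r)z+G(r)z²)`. -/
noncomputable def I2c (S T r z : ℝ) : ℝ :=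
  (Real.sqrt T + Real.sqrt S - 2 * Real.sqrt S * Real.sqrt T + Rc S T r * Real.sqrt z +
      z * (Real.sqrt T + Real.sqrt S - 2)) /
    (Ec S T r + Fc S T r * z + Gc S T r * z ^ 2)

/-- `Q_{S,T}(r) = (1+r)·∫_T^S I₂(r,z)/((1+√z)√(√z−√T)√(√S−√z)) dz`. -/
noncomputable def Qc (S T r : ℝ) : ℝ :=
  (1 + r) * ∫ z in T..S, I2c S T r z /
    ((1 + Real.sqrt z) * Real.sqrt (Real.sqrt z - Real.sqrt T) *
      Real.sqrt (Real.sqrt S - Real.sqrt z))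

theorem stmt_14 (T S : ℝ) (hT : 0 < T) (hTS : T < S) (hS : S < 1) (r : ℝ) (hr : 0 < r)
    (z : ℝ) (hz1 : T ≤ z) (hz2 : z ≤ S) :
    Ec S T r + Fc S T r * z + Gc S T r * z ^ 2 > 0 := by
  have hz : 0 < z := lt_of_lt_of_le hT hz1
  have ha : 0 < Real.sqrt T := Real.sqrt_pos.2 hT
  have hb : 0 < Real.sqrt S := Real.sqrt_pos.2 (hT.trans hTS)
  have hw : 0 < Real.sqrt z := Real.sqrt_pos.2 hz
  have ha1 : Real.sqrt T < 1 := by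
    rw [Real.sqrt_lt' one_pos]; linarith
  have hb1 : Real.sqrt S < 1 := by
    rw [Real.sqrt_lt' one_pos]; linarith
  have hw1 : Real.sqrt z < 1 := by
    rw [Real.sqrt_lt' one_pos]; linarith
  have hzw : z = Real.sqrt z ^ 2 := (Real.sq_sqrt hz.le).symm
  have hR : 0 < Rc S T r := by
    unfold Rc
    exact mul_pos (mul_pos (by linarith) (by linarith)) (by linarith)
  unfold Ec Fc Gc
  generalize Rc S T r = R at *
  generalize Real.sqrt z = w at *
  generalize Real.sqrt T = a at *
  generalize Real.sqrt S = b at *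
  rw [hzw]
  have h1 : 0 < 1 - w := by linarith
  have key : 0 < (a + b - 2 * b * a - R * w + (a + b - 2) * w ^ 2) ^ 2
      + 2 * R * (1 - w) ^ 2 * ((w + a) * (w + b)) := by positivity
  have e : (a + b - 2 * b * a) ^ 2 + 2 * R * b * a +
      (2 * (a + b - 2) * (a + b - 2 * b * a) +
        2 * R * (1 + b * a - 2 * a - 2 * b) + R ^ 2) * w ^ 2 +
      ((a + b - 2) ^ 2 + 2 * R) * (w ^ 2) ^ 2 =
      (a + b - 2 * b * a - R * w + (a + b - 2) * w ^ 2) ^ 2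
      + 2 * R * (1 - w) ^ 2 * ((w + a) * (w + b)) := by ring
  rw [e]
  exact key
end

section
/- Let 0 < T < S < 1. Then there exist constants C > 0 and r₀ > 0 such that |Q_{S,T}(r) − π/(√(1−T)·√(1−S)·√(1−√T)·√(1−√S))| ≤ C/r for every r > r₀; that is, Q_{S,T}(r) − π/(√(1−T)·√(1−S)·√(1−√T)·√(1−√S)) = O(1/r) as r → +∞. -/
open MeasureTheory

set_option maxHeartbeats 1000000 in
/-- pointwise algebraic estimate -/
lemma aux_bound (a b u r : ℝ) (ha : 0 < a) (ha1 : a < 1) (hb : 0 < b) (hb1 : b < 1)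
    (hau : a ≤ u) (hu1 : u ≤ 1) (p : ℝ) (hp : p = (1 - a) * (1 - b)) (R : ℝ)
    (hR : R = 2 * r * p) (hr : 28 / (a ^ 2 * p) < r) (m d : ℝ)
    (hm : m = (a + b - 2 * a * b) + u ^ 2 * (a + b - 2))
    (hd : d = 2 * a * b + 2 * (1 + a * b - 2 * a - 2 * b) * u ^ 2 + 2 * u ^ 4) :
    0 < R ^ 2 * u ^ 2 + R * d + m ^ 2 ∧
    |(1 + r) * (u * ((m + R * u) / (R ^ 2 * u ^ 2 + R * d + m ^ 2))) - 1 / (2 * p)|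
      ≤ (22 / (p ^ 2 * a ^ 2)) / r := by
  have hp0 : 0 < p := by rw [hp]; exact mul_pos (by linarith) (by linarith)
  have hp1 : p ≤ 1 := by rw [hp]; nlinarith
  have hu0 : 0 < u := by linarith
  have ha2 : 0 < a ^ 2 := by positivity
  have ha21 : a ^ 2 ≤ 1 := by nlinarith
  have hr0 : 0 < r := lt_trans (by positivity) hr
  have hR0 : 0 < R := by rw [hR]; positivity
  rw [div_lt_iff₀ (by positivity)] at hr
  have hRa : 56 ≤ R * a ^ 2 := by rw [hR]; nlinarith
  have hR1 : 56 ≤ R := by nlinarith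
  have hab0 : 0 < a * b := by positivity
  have hab1 : a * b < 1 := by nlinarith
  have hu2 : u ^ 2 ≤ 1 := by nlinarith
  have hu20 : 0 < u ^ 2 := by positivity
  have hu4 : u ^ 4 ≤ 1 := by nlinarith
  have hu40 : 0 < u ^ 4 := by positivity
  have hm4 : |m| ≤ 4 := by
    rw [hm, abs_le]; constructor <;> nlinarith
  have hdd : |d| ≤ 14 := by
    rw [hd, abs_le]
    constructor <;> nlinarith
  have h1 := abs_le.1 hm4
  have h2 := abs_le.1 hdd
  have hau2 : a ^ 2 ≤ u ^ 2 := by nlinarith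
  have hD : R ^ 2 * a ^ 2 / 2 ≤ R ^ 2 * u ^ 2 + R * d + m ^ 2 := by
    have e1 : R ^ 2 * a ^ 2 ≤ R ^ 2 * u ^ 2 := by gcongr
    have e2 : R * (-14) ≤ R * d := mul_le_mul_of_nonneg_left h2.1 hR0.le
    have e3 : R * 56 ≤ R * (R * a ^ 2) := mul_le_mul_of_nonneg_left hRa hR0.le
    nlinarith [sq_nonneg m]
  have hD0 : 0 < R ^ 2 * u ^ 2 + R * d + m ^ 2 := lt_of_lt_of_le (by positivity) hD
  refine ⟨hD0, ?_⟩
  set D := R ^ 2 * u ^ 2 + R * d + m ^ 2 with hDdef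
  have key : (1 + r) * (u * ((m + R * u) / D)) - 1 / (2 * p)
      = (R * (2 * p * u ^ 2 + u * m - d) + (2 * p * u * m - m ^ 2)) / (2 * p * D) := by
    have : (1 + r) * (u * ((m + R * u) / D)) - 1 / (2 * p)
      = ((2 * p + R) * u * (m + R * u) - D) / (2 * p * D) := by
      rw [hR]; field_simp
    rw [this, hDdef]; congr 1; ring
  have hum : |u * m| ≤ 4 := by
    rw [abs_mul, abs_of_pos hu0]
    calc u * |m| ≤ 1 * 4 := mul_le_mul hu1 hm4 (abs_nonneg m) zero_le_one
      _ = 4 := by norm_num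
  have h3 := abs_le.1 hum
  have hpu : p * u ^ 2 ≤ 1 := mul_le_one₀ hp1 hu20.le hu2
  have hpu0 : 0 < p * u ^ 2 := by positivity
  have hN1 : |2 * p * u ^ 2 + u * m - d| ≤ 20 := by
    rw [abs_le]; constructor <;> linarith
  have hN2 : |2 * p * u * m - m ^ 2| ≤ 24 := by
    have e1 : |2 * p * u * m| ≤ 8 := by
      have : 2 * p * u * m = (2 * p) * (u * m) := by ring
      rw [this, abs_mul, abs_of_pos (by positivity : 0 < 2 * p)]
      calc 2 * p * |u * m| ≤ 2 * 4 :=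
            mul_le_mul (by linarith) hum (abs_nonneg _) (by norm_num)
        _ = 8 := by norm_num
    have e2 := abs_le.1 e1
    have e3 : m ^ 2 ≤ 16 := by
      have := pow_le_pow_left₀ (abs_nonneg m) hm4 2
      rw [sq_abs] at this
      linarith
    have e4 := sq_nonneg m
    rw [abs_le]; constructor <;> linarith
  have hN : |R * (2 * p * u ^ 2 + u * m - d) + (2 * p * u * m - m ^ 2)| ≤ 44 * R := by
    refine (abs_add_le _ _).trans ?_
    rw [abs_mul, abs_of_pos hR0]
    have := mul_le_mul_of_nonneg_left hN1 hR0.le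
    linarith
  rw [key, abs_div, abs_of_pos (by positivity : 0 < 2 * p * D)]
  calc _ ≤ 44 * R / (2 * p * (R ^ 2 * a ^ 2 / 2)) := by gcongr
    _ = (22 / (p ^ 2 * a ^ 2)) / r := by rw [hR]; field_simp; norm_num

/-- the limiting kernel -/
noncomputable def kern (a b z : ℝ) : ℝ :=
  1 / (Real.sqrt z * ((1 + Real.sqrt z) * Real.sqrt (Real.sqrt z - a) *
      Real.sqrt (b - Real.sqrt z)))

lemma kern_int (T S : ℝ) (hT : 0 < T) (hTS : T < S) (a b : ℝ) (ha : a = Real.sqrt T)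
    (hb : b = Real.sqrt S) :
    IntervalIntegrable (kern a b) volume T S ∧
    ∫ z in T..S, kern a b z = 2 * Real.pi / (Real.sqrt (1 + a) * Real.sqrt (1 + b)) := by
  have ha0 : 0 < a := by rw [ha]; positivity
  have hab : a < b := by rw [ha, hb]; exact Real.sqrt_lt_sqrt hT.le hTS
  set A := 1 + a with hA
  set B := 1 + b with hB
  have hA0 : 0 < A := by positivity
  have hAB : A < B := by simp [hA, hB, hab]
  have hB0 : 0 < B := by linarith
  have hBA : 0 < B - A := by linarith
  let W : ℝ → ℝ := fun z => ((A + B) * (1 + Real.sqrt z) - 2 * A * B) / ((B - A) * (1 + Real.sqrt z))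
  let Φ : ℝ → ℝ := fun z => (2 / (Real.sqrt A * Real.sqrt B)) * Real.arcsin (W z)
  have hcont : ContinuousOn Φ (Set.Icc T S) := by
    have : Continuous Φ := by
      refine continuous_const.mul (Real.continuous_arcsin.comp ?_)
      refine Continuous.div (by fun_prop) (by fun_prop) ?_
      intro z
      have := Real.sqrt_nonneg z
      positivity
    exact this.continuousOn
  have hderiv : ∀ z ∈ Set.Ioo T S, HasDerivAt Φ (kern a b z) z := by
    intro z hz
    have hz0 : 0 < z := hT.trans hz.1
    have hu0 : 0 < Real.sqrt z := by positivity
    have hua : a < Real.sqrt z := by rw [ha]; exact Real.sqrt_lt_sqrt hT.le hz.1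
    have hub : Real.sqrt z < b := by rw [hb]; exact Real.sqrt_lt_sqrt hz0.le hz.2
    set u := Real.sqrt z with hu
    have hv0 : 0 < 1 + u := by positivity
    have hs : HasDerivAt Real.sqrt (1 / (2 * u)) z := Real.hasDerivAt_sqrt hz0.ne'
    have hW : HasDerivAt W (2 * A * B / ((B - A) * (1 + u) ^ 2) * (1 / (2 * u))) z := by
      have h1 : HasDerivAt (fun z => (A + B) * (1 + Real.sqrt z) - 2 * A * B)
          ((A + B) * (1 / (2 * u))) z := ((hs.const_add 1).const_mul (A + B)).sub_const _
      have h2 : HasDerivAt (fun z => (B - A) * (1 + Real.sqrt z))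
          ((B - A) * (1 / (2 * u))) z := (hs.const_add 1).const_mul (B - A)
      have h3 := h1.div h2 (by rw [← hu]; positivity)
      refine h3.congr_deriv ?_
      rw [← hu]
      field_simp
      ring
    have hua' : 0 < u - a := by linarith
    have hub' : 0 < b - u := by linarith
    have hW1 : 1 - W z ^ 2 = (2 * (Real.sqrt A * Real.sqrt B) * (Real.sqrt (u - a) * Real.sqrt (b - u))
        / ((B - A) * (1 + u))) ^ 2 := by
      have e : (2 * (Real.sqrt A * Real.sqrt B) * (Real.sqrt (u - a) * Real.sqrt (b - u))
        / ((B - A) * (1 + u))) ^ 2 = 4 * (A * B) * ((u - a) * (b - u)) / ((B - A) * (1 + u)) ^ 2 := by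
        rw [div_pow]
        congr 1
        rw [mul_pow, mul_pow, mul_pow, mul_pow, Real.sq_sqrt hA0.le, Real.sq_sqrt hB0.le,
          Real.sq_sqrt hua'.le, Real.sq_sqrt hub'.le]
        norm_num
      rw [e]
      simp only [W, ← hu]
      field_simp
      rw [hA, hB]
      ring
    have hpos : 0 < 2 * (Real.sqrt A * Real.sqrt B) * (Real.sqrt (u - a) * Real.sqrt (b - u))
        / ((B - A) * (1 + u)) := by positivity
    have hlt : W z ^ 2 < 1 := by
      have : 0 < 1 - W z ^ 2 := by rw [hW1]; positivity
      linarith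
    have hlt' := abs_lt.1 ((sq_lt_one_iff_abs_lt_one _).1 hlt)
    have h4 := ((Real.hasDerivAt_arcsin hlt'.1.ne' hlt'.2.ne).comp z hW).const_mul
      (2 / (Real.sqrt A * Real.sqrt B))
    refine h4.congr_deriv ?_
    rw [hW1, Real.sqrt_sq hpos.le]
    simp only [kern, ← hu]
    have hsA : Real.sqrt A ^ 2 = A := Real.sq_sqrt hA0.le
    have hsB : Real.sqrt B ^ 2 = B := Real.sq_sqrt hB0.le
    have q1 : 0 < Real.sqrt A := by positivity
    have q2 : 0 < Real.sqrt B := by positivity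
    have q3 : 0 < Real.sqrt (u - a) := by positivity
    have q4 : 0 < Real.sqrt (b - u) := by positivity
    field_simp
    rw [hsA, hsB]
    ring
  have hnn : ∀ z ∈ Set.Ioo T S, 0 ≤ kern a b z := by
    intro z _
    unfold kern
    have := Real.sqrt_nonneg z
    positivity
  have hii : IntervalIntegrable (kern a b) volume T S := by
    apply intervalIntegral.intervalIntegrable_deriv_of_nonneg (g := Φ)
    · rwa [Set.uIcc_of_le hTS.le]
    · rw [min_eq_left hTS.le, max_eq_right hTS.le]; exact hderiv
    · rw [min_eq_left hTS.le, max_eq_right hTS.le]; exact hnn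
  refine ⟨hii, ?_⟩
  rw [intervalIntegral.integral_eq_sub_of_hasDerivAt_of_le hTS.le hcont hderiv hii]
  have w1 : W S = 1 := by
    simp only [W, ← hb, ← hB]
    field_simp
    ring
  have w2 : W T = -1 := by
    simp only [W, ← ha, ← hA]
    field_simp
    ring
  simp only [Φ, w1, w2, Real.arcsin_one, Real.arcsin_neg_one]
  ring

theorem stmt_17 (T S : ℝ) (hT : 0 < T) (hTS : T < S) (hS : S < 1) :
    ∃ C > (0 : ℝ), ∃ r₀ > (0 : ℝ), ∀ r > r₀,
      |Qc S T r - Real.pi / (Real.sqrt (1 - T) * Real.sqrt (1 - S) *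
        Real.sqrt (1 - Real.sqrt T) * Real.sqrt (1 - Real.sqrt S))| ≤ C / r := by
  obtain ⟨a, ha⟩ : ∃ a, a = Real.sqrt T := ⟨_, rfl⟩
  obtain ⟨b, hb⟩ : ∃ b, b = Real.sqrt S := ⟨_, rfl⟩
  obtain ⟨hki, hkv⟩ := kern_int T S hT hTS a b ha hb
  have hS0 : 0 < S := hT.trans hTS
  have ha0 : 0 < a := by rw [ha]; positivity
  have hab : a < b := by rw [ha, hb]; exact Real.sqrt_lt_sqrt hT.le hTS
  have hb1 : b < 1 := by rw [hb, Real.sqrt_lt' one_pos]; simpa using hS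
  have hTa : T = a ^ 2 := by rw [ha, Real.sq_sqrt hT.le]
  have hSb : S = b ^ 2 := by rw [hb, Real.sq_sqrt hS0.le]
  obtain ⟨p, hp⟩ : ∃ p, p = (1 - a) * (1 - b) := ⟨_, rfl⟩
  have ha1 : 0 < 1 - a := by linarith
  have hb1' : 0 < 1 - b := by linarith
  have hp0 : 0 < p := by rw [hp]; positivity
  have hb0 : 0 < b := by linarith
  have hval : Real.pi / (Real.sqrt (1 - T) * Real.sqrt (1 - S) *
        Real.sqrt (1 - Real.sqrt T) * Real.sqrt (1 - Real.sqrt S)) =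
      ∫ z in T..S, 1 / (2 * p) * kern a b z := by
    rw [intervalIntegral.integral_const_mul, hkv, ← ha, ← hb, hp]
    have e1 : Real.sqrt (1 - T) = Real.sqrt (1 - a) * Real.sqrt (1 + a) := by
      rw [← Real.sqrt_mul ha1.le, hTa]; congr 1; ring
    have e2 : Real.sqrt (1 - S) = Real.sqrt (1 - b) * Real.sqrt (1 + b) := by
      rw [← Real.sqrt_mul hb1'.le, hSb]; congr 1; ring
    have s1 : Real.sqrt (1 - a) ^ 2 = 1 - a := Real.sq_sqrt ha1.le
    have s2 : Real.sqrt (1 - b) ^ 2 = 1 - b := Real.sq_sqrt hb1'.le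
    have q1 : 0 < Real.sqrt (1 - a) := by positivity
    have q2 : 0 < Real.sqrt (1 - b) := by positivity
    have q3 : 0 < Real.sqrt (1 + a) := by positivity
    have q4 : 0 < Real.sqrt (1 + b) := by positivity
    rw [e1, e2]
    field_simp
    rw [s1, s2]
  have hknn : ∀ z, 0 ≤ kern a b z := by
    intro z
    unfold kern
    have := Real.sqrt_nonneg z
    positivity
  have hI0 : 0 ≤ ∫ z in T..S, kern a b z :=
    intervalIntegral.integral_nonneg hTS.le (fun z _ => hknn z)
  refine ⟨22 / (p ^ 2 * a ^ 2) * (∫ z in T..S, kern a b z) + 1, by positivity,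
    28 / (a ^ 2 * p), by positivity, ?_⟩
  intro r hr
  have hr0 : 0 < r := lt_trans (by positivity) hr
  have hfact : ∀ z ∈ Set.Icc T S, 0 < Ec S T r + Fc S T r * z + Gc S T r * z ^ 2 ∧
      |(1 + r) * (Real.sqrt z * I2c S T r z) - 1 / (2 * p)| ≤ (22 / (p ^ 2 * a ^ 2)) / r := by
    intro z hz
    have hz0 : 0 < z := lt_of_lt_of_le hT hz.1
    have hzu : Real.sqrt z ^ 2 = z := Real.sq_sqrt hz0.le
    have h := aux_bound a b (Real.sqrt z) r ha0 (by linarith) hb0 hb1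
      (by rw [ha]; exact Real.sqrt_le_sqrt hz.1)
      ((Real.sqrt_le_sqrt (hz.2.trans hS.le)).trans Real.sqrt_one.le) p hp (2 * r * p) rfl hr _ _ rfl rfl
    have hden : Ec S T r + Fc S T r * z + Gc S T r * z ^ 2 =
      (2 * r * p) ^ 2 * Real.sqrt z ^ 2 + (2 * r * p) *
        (2 * a * b + 2 * (1 + a * b - 2 * a - 2 * b) * Real.sqrt z ^ 2 + 2 * Real.sqrt z ^ 4)
        + ((a + b - 2 * a * b) + Real.sqrt z ^ 2 * (a + b - 2)) ^ 2 := by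
      have : Real.sqrt z ^ 4 = z ^ 2 := by rw [← hzu]; simp; ring
      simp only [Ec, Fc, Gc, Rc, ← ha, ← hb, this, hzu, hp]
      ring
    have hnum : Real.sqrt T + Real.sqrt S - 2 * Real.sqrt S * Real.sqrt T + Rc S T r * Real.sqrt z +
      z * (Real.sqrt T + Real.sqrt S - 2) =
      ((a + b - 2 * a * b) + Real.sqrt z ^ 2 * (a + b - 2)) + 2 * r * p * Real.sqrt z := by
      simp only [Rc, ← ha, ← hb, hzu, hp]
      ring
    unfold I2c
    rw [hnum, hden]
    exact h
  have hpt : ∀ z ∈ Set.Icc T S, I2c S T r z /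
    ((1 + Real.sqrt z) * Real.sqrt (Real.sqrt z - Real.sqrt T) *
      Real.sqrt (Real.sqrt S - Real.sqrt z)) = (Real.sqrt z * I2c S T r z) * kern a b z := by
    intro z hz
    have hz0 : 0 < z := lt_of_lt_of_le hT hz.1
    have : 0 < Real.sqrt z := by positivity
    rw [← ha, ← hb, kern, div_eq_mul_inv, one_div, mul_inv (Real.sqrt z)]
    field_simp
  have hQ : Qc S T r = ∫ z in T..S, (1 + r) * (Real.sqrt z * I2c S T r z) * kern a b z := by
    unfold Qc
    rw [← intervalIntegral.integral_const_mul]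
    apply intervalIntegral.integral_congr
    intro z hz
    rw [Set.uIcc_of_le hTS.le] at hz
    simp only [hpt z hz]
    ring
  have hcontI : ContinuousOn (fun z => (1 + r) * (Real.sqrt z * I2c S T r z)) (Set.uIcc T S) := by
    rw [Set.uIcc_of_le hTS.le]
    refine continuousOn_const.mul (Real.continuous_sqrt.continuousOn.mul ?_)
    unfold I2c
    refine ContinuousOn.div (by fun_prop) (by fun_prop) ?_
    intro z hz
    exact (hfact z hz).1.ne'
  have hint1 := hki.continuousOn_mul hcontI
  rw [hval, hQ, ← intervalIntegral.integral_sub hint1 (hki.const_mul _)]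
  have hb := intervalIntegral.norm_integral_le_of_norm_le (μ := volume) hTS.le
    (f := fun z => (1 + r) * (Real.sqrt z * I2c S T r z) * kern a b z - 1 / (2 * p) * kern a b z)
    (g := fun z => (22 / (p ^ 2 * a ^ 2)) / r * kern a b z)
    (Filter.Eventually.of_forall (by
      intro z hz
      rw [← sub_mul, Real.norm_eq_abs, abs_mul, abs_of_nonneg (hknn z)]
      exact mul_le_mul_of_nonneg_right (hfact z ⟨hz.1.le, hz.2⟩).2 (hknn z)))
    (hki.const_mul _)
  rw [Real.norm_eq_abs, intervalIntegral.integral_const_mul] at hb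
  refine hb.trans ?_
  rw [div_mul_eq_mul_div]
  gcongr
  linarith
end
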